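/- arXiv:1009.3959 — 8 statements merged into one kernel-verified Lean document; each statement's English description precedes it below -/
import Mathlib

section
/- Let p, r ∈ [0,1] with r < p and p − r < 1, let Q(x) = x·p + (1−x)·r and π⁰ = r/(1+r−p). Suppose π, π* ∈ [0,1] satisfy π ≤ π* < π⁰. Then the hitting time L(π, π*) := min{ t ∈ ℕ : Q^t(π) > π* } is finite and equals ⌊ log_{p−r} ( (r − (1+r−p)·π*) / (r − (1+r−p)·π) ) ⌋ + 1, where log_{p−r}(x) = ln(x)/ln(p−r). -/
open Set

theorem affine_iterate_deviation {p r : ℝ} {Q : ℝ → ℝ}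
    (hQ : ∀ x, Q x = x * p + (1 - x) * r) (x : ℝ) (t : ℕ) :
    r - (1 + r - p) * Q^[t] x = (p - r) ^ t * (r - (1 + r - p) * x) := by
  induction t with
  | zero => simp
  | succ t ih =>
    rw [Function.iterate_succ_apply', hQ, pow_succ]
    linear_combination (p - r) * ih

theorem isLeast_setOf_lt_natCast {x : ℝ} (hx : 0 ≤ x) :
    IsLeast {t : ℕ | x < t} (⌊x⌋₊ + 1) :=
  ⟨by simpa using Nat.lt_floor_add_one x, fun _ ht => (Nat.floor_lt hx).2 ht⟩

/-- Hitting-time formula for a positively correlated channel: if `π ≤ π* < π⁰`, the first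
time the idle belief iterates exceed `π*` is finite and equals
`⌊log_{p-r}((r - (1+r-p)π*)/(r - (1+r-p)π))⌋ + 1`. -/
theorem stmt_7 (p r : ℝ) (hp : p ∈ Icc (0:ℝ) 1) (hr : r ∈ Icc (0:ℝ) 1)
    (hrp : r < p) (hpr : p - r < 1)
    (Q : ℝ → ℝ) (hQ : ∀ x, Q x = x * p + (1 - x) * r)
    (π0 : ℝ) (hπ0 : π0 = r / (1 + r - p))
    (π πs : ℝ) (hπ : π ∈ Icc (0:ℝ) 1) (hπs : πs ∈ Icc (0:ℝ) 1)
    (h1 : π ≤ πs) (h2 : πs < π0) :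
    {t : ℕ | πs < Q^[t] π}.Nonempty ∧
    ((sInf {t : ℕ | πs < Q^[t] π} : ℕ) : ℤ) =
      ⌊Real.log ((r - (1 + r - p) * πs) / (r - (1 + r - p) * π)) /
          Real.log (p - r)⌋ + 1 := by
  have ha : 0 < p - r := sub_pos.2 hrp
  have hc : 0 < 1 + r - p := by linarith
  have hA : 0 < r - (1 + r - p) * πs := by
    rw [hπ0, lt_div_iff₀ hc] at h2
    linarith
  have hAB : r - (1 + r - p) * πs ≤ r - (1 + r - p) * π := by gcongr
  have hB := hA.trans_le hAB
  have hlog : Real.log (p - r) < 0 := Real.log_neg ha hpr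
  set x := Real.log ((r - (1 + r - p) * πs) / (r - (1 + r - p) * π)) / Real.log (p - r) with hx
  have hx0 : 0 ≤ x :=
    div_nonneg_of_nonpos (Real.log_nonpos (div_pos hA hB).le (div_le_one_of_le₀ hAB hB.le)) hlog.le
  have hset : {t : ℕ | πs < Q^[t] π} = {t : ℕ | x < t} := by
    ext t
    calc πs < Q^[t] π
        ↔ r - (1 + r - p) * Q^[t] π < r - (1 + r - p) * πs := by
          rw [sub_lt_sub_iff_left, mul_lt_mul_iff_right₀ hc]
      _ ↔ (p - r) ^ t < (r - (1 + r - p) * πs) / (r - (1 + r - p) * π) := by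
          rw [affine_iterate_deviation hQ, lt_div_iff₀ hB]
      _ ↔ x < t := by
          rw [hx, div_lt_iff_of_neg hlog, ← Real.log_pow,
            Real.log_lt_log_iff (pow_pos ha t) (div_pos hA hB)]
  have hleast := isLeast_setOf_lt_natCast hx0
  rw [hset, hleast.csInf_eq]
  exact ⟨⟨_, hleast.1⟩, by rw [Nat.cast_succ, Int.natCast_floor_eq_floor hx0]⟩
end

section
/- Let β ∈ [0,1), ω ∈ ℝ, p, r ∈ [0,1], Q(x) = x·p + (1−x)·r, and let R : [0,1] → ℝ be convex. Fix M ≥ 1 and define functions V_{M−1}, V_{M−2}, …, V_0 on [0,1] by backward recursion: V_{M−1}(π) = max{ ω, R(π) } and, for 0 ≤ t < M−1, V_t(π) = max{ ω + β·V_{t+1}(Q(π)), R(π) + β·( π·V_{t+1}(p) + (1−π)·V_{t+1}(r) ) }. Then every V_t is convex on [0,1]. -/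
open Set

/-- A real function interpolating linearly between two values is convex on any convex set. -/
theorem convexOn_mul_add_one_sub_mul {s : Set ℝ} (hs : Convex ℝ s) (a b : ℝ) :
    ConvexOn ℝ s fun x => x * a + (1 - x) * b := by
  refine ⟨hs, fun x _ y _ u v _ _ huv => le_of_eq ?_⟩
  simp only [smul_eq_mul]
  linear_combination (-b) * huv

/-- Precomposing a convex function on `[0,1]` with the linear interpolation between two points
of `[0,1]` gives a convex function on `[0,1]`. -/
theorem ConvexOn.comp_mul_add_one_sub_mul {W : ℝ → ℝ} (hW : ConvexOn ℝ (Icc (0:ℝ) 1) W)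
    {p r : ℝ} (hp : p ∈ Icc (0:ℝ) 1) (hr : r ∈ Icc (0:ℝ) 1) :
    ConvexOn ℝ (Icc (0:ℝ) 1) fun x => W (x * p + (1 - x) * r) := by
  have hline : ∀ x, AffineMap.lineMap r p x = x * p + (1 - x) * r := fun x => by
    rw [AffineMap.lineMap_apply_ring]; ring
  refine ((hW.comp_affineMap (AffineMap.lineMap r p)).subset (fun x hx => ?_)
    (convex_Icc 0 1)).congr fun x _ => congrArg W (hline x)
  rw [mem_preimage, hline]
  exact convex_Icc (0:ℝ) 1 hp hr hx.1 (sub_nonneg.2 hx.2) (add_sub_cancel x 1)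

/-- The Bellman operator of the `ω`-subsidy problem preserves convexity on `[0,1]`. -/
theorem ConvexOn.bellman_step {β p r : ℝ} (hβ : 0 ≤ β) (hp : p ∈ Icc (0:ℝ) 1)
    (hr : r ∈ Icc (0:ℝ) 1) (ω : ℝ) {R W : ℝ → ℝ} (hR : ConvexOn ℝ (Icc (0:ℝ) 1) R)
    (hW : ConvexOn ℝ (Icc (0:ℝ) 1) W) :
    ConvexOn ℝ (Icc (0:ℝ) 1) fun x =>
      max (ω + β * W (x * p + (1 - x) * r)) (R x + β * (x * W p + (1 - x) * W r)) :=
  ((convexOn_const ω (convex_Icc 0 1)).add ((hW.comp_mul_add_one_sub_mul hp hr).smul hβ)).sup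
    (hR.add ((convexOn_mul_add_one_sub_mul (convex_Icc 0 1) (W p) (W r)).smul hβ))

/-- Finite-horizon convexity: the backward-recursion value functions of the `M`-stage
`ω`-subsidy problem are all convex on `[0,1]` whenever the immediate reward `R` is. -/
theorem stmt_8 (β ω : ℝ) (hβ : β ∈ Ico (0:ℝ) 1)
    (p r : ℝ) (hp : p ∈ Icc (0:ℝ) 1) (hr : r ∈ Icc (0:ℝ) 1)
    (Q : ℝ → ℝ) (hQ : ∀ x, Q x = x * p + (1 - x) * r)
    (R : ℝ → ℝ) (hRconv : ConvexOn ℝ (Icc (0:ℝ) 1) R)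
    (M : ℕ) (hM : 1 ≤ M) (V : ℕ → ℝ → ℝ)
    (hlast : ∀ π ∈ Icc (0:ℝ) 1, V (M - 1) π = max ω (R π))
    (hstep : ∀ t, t < M - 1 → ∀ π ∈ Icc (0:ℝ) 1,
      V t π = max (ω + β * V (t + 1) (Q π))
        (R π + β * (π * V (t + 1) p + (1 - π) * V (t + 1) r))) :
    ∀ t, t ≤ M - 1 → ConvexOn ℝ (Icc (0:ℝ) 1) (V t) := by
  intro t ht
  refine Nat.decreasingInduction' (P := fun t => ConvexOn ℝ (Icc (0:ℝ) 1) (V t))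
    (fun k hk _ ih => ?_) ht ?_
  · refine (hRconv.bellman_step hβ.1 hp hr ω ih).congr fun x hx => ?_
    rw [hstep k hk x hx, hQ]
  · exact ((convexOn_const ω (convex_Icc 0 1)).sup hRconv).congr fun x hx => (hlast x hx).symm
end

section
/- Let β ∈ [0,1), ω ∈ ℝ, p, r ∈ [0,1], Q(x) = x·p + (1−x)·r, and let R : [0,1] → ℝ be bounded and convex. Then the unique bounded function V_ω : [0,1] → ℝ satisfying the Bellman equation V_ω(π) = max{ R(π) + β·( π·V_ω(p) + (1−π)·V_ω(r) ), ω + β·V_ω(Q(π)) } for all π ∈ [0,1] is convex on [0,1]. -/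
open Set

/-- Proposition 1: the bounded solution of the Bellman equation of the `ω`-subsidy
problem is convex on `[0,1]` whenever the immediate reward `R` is bounded and convex. -/
theorem stmt_10 (β ω : ℝ) (hβ : β ∈ Ico (0:ℝ) 1)
    (p r : ℝ) (hp : p ∈ Icc (0:ℝ) 1) (hr : r ∈ Icc (0:ℝ) 1)
    (Q : ℝ → ℝ) (hQ : ∀ x, Q x = x * p + (1 - x) * r)
    (R : ℝ → ℝ) (hRbd : ∃ C : ℝ, ∀ π ∈ Icc (0:ℝ) 1, |R π| ≤ C)
    (hRconv : ConvexOn ℝ (Icc (0:ℝ) 1) R)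
    (V : ℝ → ℝ) (hVbd : ∃ C : ℝ, ∀ π ∈ Icc (0:ℝ) 1, |V π| ≤ C)
    (hV : ∀ π ∈ Icc (0:ℝ) 1,
      V π = max (R π + β * (π * V p + (1 - π) * V r)) (ω + β * V (Q π))) :
    ConvexOn ℝ (Icc (0:ℝ) 1) V := by
  obtain ⟨C, hC⟩ := hVbd
  obtain ⟨hβ0, hβ1⟩ := hβ
  have hI : Convex ℝ (Icc (0:ℝ) 1) := convex_Icc 0 1
  have hQI : ∀ x ∈ Icc (0:ℝ) 1, Q x ∈ Icc (0:ℝ) 1 := fun x hx => by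
    rw [hQ]
    exact hI hp hr hx.1 (sub_nonneg.2 hx.2) (add_sub_cancel _ _)
  have defect : ∀ n : ℕ, ∀ x ∈ Icc (0:ℝ) 1, ∀ y ∈ Icc (0:ℝ) 1, ∀ a b : ℝ, 0 ≤ a → 0 ≤ b →
      a + b = 1 → V (a * x + b * y) ≤ a * V x + b * V y + β ^ n * (2 * C) := by
    intro n
    induction n with
    | zero =>
      intro x hx y hy a b ha hb hab
      have hz := (abs_le.1 (hC _ (hI hx hy ha hb hab))).2
      have hVx := mul_le_mul_of_nonneg_left (abs_le.1 (hC x hx)).1 ha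
      have hVy := mul_le_mul_of_nonneg_left (abs_le.1 (hC y hy)).1 hb
      have hsum : a * -C + b * -C = -C := by rw [← add_mul, hab, one_mul]
      simp only [smul_eq_mul] at hz
      linarith
    | succ n ih =>
      intro x hx y hy a b ha hb hab
      have hVx := hV x hx
      have hVy := hV y hy
      have hC0 : 0 ≤ C := (abs_nonneg _).trans (hC x hx)
      have hpos : 0 ≤ β ^ (n + 1) * (2 * C) := by positivity
      have hb' : b = 1 - a := by linarith
      have hz : a * x + b * y ∈ Icc (0:ℝ) 1 := hI hx hy ha hb hab
      rw [hV _ hz]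
      apply max_le
      · have hR : R (a * x + b * y) ≤ a * R x + b * R y := hRconv.2 hx hy ha hb hab
        have h1 := mul_le_mul_of_nonneg_left (hVx ▸ le_max_left _ _ :
          R x + β * (x * V p + (1 - x) * V r) ≤ V x) ha
        have h2 := mul_le_mul_of_nonneg_left (hVy ▸ le_max_left _ _ :
          R y + β * (y * V p + (1 - y) * V r) ≤ V y) hb
        subst hb'
        linarith
      · have hQz : Q (a * x + b * y) = a * Q x + b * Q y := by
          simp only [hQ, hb']
          ring
        have h1 := mul_le_mul_of_nonneg_left (hVx ▸ le_max_right _ _ :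
          ω + β * V (Q x) ≤ V x) ha
        have h2 := mul_le_mul_of_nonneg_left (hVy ▸ le_max_right _ _ :
          ω + β * V (Q y) ≤ V y) hb
        have h3 := mul_le_mul_of_nonneg_left
          (ih _ (hQI x hx) _ (hQI y hy) a b ha hb hab) hβ0
        rw [hQz, pow_succ]
        subst hb'
        linarith
  refine ⟨hI, fun x hx y hy a b ha hb hab => ?_⟩
  have hlim : Filter.Tendsto (fun n : ℕ => a * V x + b * V y + β ^ n * (2 * C)) Filter.atTop
      (nhds (a * V x + b * V y)) := by
    simpa using ((tendsto_pow_atTop_nhds_zero_of_lt_one hβ0 hβ1).mul_const (2 * C)).const_add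
      (a * V x + b * V y)
  exact ge_of_tendsto' hlim fun n => defect n x hx y hy a b ha hb hab
end

section
/- Let β ∈ [0,1), δ ∈ [0,1), p, r ∈ [0,1], Q(x) = x·p + (1−x)·r, and let R : [0,1] → ℝ be bounded and convex with δ ≤ R(π) for all π ∈ [0,1]. Let V_ω be the unique bounded solution of the Bellman equation V_ω(π) = max{ R(π) + β·( π·V_ω(p) + (1−π)·V_ω(r) ), ω + β·V_ω(Q(π)) }. If ω ≤ δ, then for every π ∈ [0,1] the active branch attains the maximum: ω + β·V_ω(Q(π)) ≤ R(π) + β·( π·V_ω(p) + (1−π)·V_ω(r) ). -/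
open Set

/-- A bounded solution of the Bellman equation with a convex reward is convex. -/
theorem convexOn_of_bellman {β ω p r C : ℝ} (hβ : β ∈ Ico (0:ℝ) 1)
    (hp : p ∈ Icc (0:ℝ) 1) (hr : r ∈ Icc (0:ℝ) 1) {R V : ℝ → ℝ}
    (hR : ConvexOn ℝ (Icc (0:ℝ) 1) R) (hC : ∀ x ∈ Icc (0:ℝ) 1, |V x| ≤ C)
    (hV : ∀ x ∈ Icc (0:ℝ) 1,
      V x = max (R x + β * (x * V p + (1 - x) * V r)) (ω + β * V (x * p + (1 - x) * r))) :
    ConvexOn ℝ (Icc (0:ℝ) 1) V := by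
  have hconv : Convex ℝ (Icc (0:ℝ) 1) := convex_Icc 0 1
  have hC0 : 0 ≤ C := (abs_nonneg _).trans (hC p hp)
  have hQ : ∀ x ∈ Icc (0:ℝ) 1, x * p + (1 - x) * r ∈ Icc (0:ℝ) 1 := fun x hx =>
    hconv hp hr hx.1 (sub_nonneg.2 hx.2) (by ring)
  have gap : ∀ n : ℕ, ∀ x ∈ Icc (0:ℝ) 1, ∀ y ∈ Icc (0:ℝ) 1, ∀ a b : ℝ, 0 ≤ a → 0 ≤ b →
      a + b = 1 → V (a * x + b * y) - (a * V x + b * V y) ≤ β ^ n * (2 * C) := by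
    intro n
    induction n with
    | zero =>
      intro x hx y hy a b ha hb hab
      have hz := (abs_le.1 (hC _ (hconv hx hy ha hb hab))).2
      simp only [smul_eq_mul] at hz
      have h₁ := mul_le_mul_of_nonneg_left (abs_le.1 (hC x hx)).1 ha
      have h₂ := mul_le_mul_of_nonneg_left (abs_le.1 (hC y hy)).1 hb
      have h₃ : a * -C + b * -C = -C := by rw [← add_mul, hab, one_mul]
      linarith
    | succ n ih =>
      intro x hx y hy a b ha hb hab
      have hx₁ := mul_le_mul_of_nonneg_left ((le_max_left _ _).trans (hV x hx).ge) ha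
      have hx₂ := mul_le_mul_of_nonneg_left ((le_max_right _ _).trans (hV x hx).ge) ha
      have hy₁ := mul_le_mul_of_nonneg_left ((le_max_left _ _).trans (hV y hy).ge) hb
      have hy₂ := mul_le_mul_of_nonneg_left ((le_max_right _ _).trans (hV y hy).ge) hb
      have hRz := hR.2 hx hy ha hb hab
      have hVz := hV _ (hconv hx hy ha hb hab)
      simp only [smul_eq_mul] at hRz hVz
      have hpos : 0 ≤ β ^ (n + 1) * (2 * C) :=
        mul_nonneg (pow_nonneg hβ.1 _) (mul_nonneg zero_le_two hC0)
      have hQz : (a * x + b * y) * p + (1 - (a * x + b * y)) * r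
          = a * (x * p + (1 - x) * r) + b * (y * p + (1 - y) * r) := by
        linear_combination (-r) * hab
      rw [sub_le_iff_le_add, hVz, hQz]
      obtain rfl : b = 1 - a := by linarith
      refine max_le (by linarith) ?_
      have h := mul_le_mul_of_nonneg_left (ih _ (hQ x hx) _ (hQ y hy) a _ ha hb hab) hβ.1
      rw [pow_succ]
      linarith
  refine ⟨hconv, fun x hx y hy a b ha hb hab => ?_⟩
  have hlim : Filter.Tendsto (fun n : ℕ => β ^ n * (2 * C)) Filter.atTop (nhds 0) := by
    simpa using (tendsto_pow_atTop_nhds_zero_of_lt_one hβ.1 hβ.2).mul_const (2 * C)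
  exact sub_nonpos.1 (ge_of_tendsto' hlim fun n => gap n x hx y hy a b ha hb hab)

/-- Case (ii) of Proposition 2: if `ω ≤ δ ≤ R`, the active branch of the Bellman equation
always attains the maximum. -/
theorem stmt_12 (β ω δ : ℝ) (hβ : β ∈ Ico (0:ℝ) 1) (hδ : δ ∈ Ico (0:ℝ) 1)
    (p r : ℝ) (hp : p ∈ Icc (0:ℝ) 1) (hr : r ∈ Icc (0:ℝ) 1)
    (Q : ℝ → ℝ) (hQ : ∀ x, Q x = x * p + (1 - x) * r)
    (R : ℝ → ℝ) (hRbd : ∃ C : ℝ, ∀ π ∈ Icc (0:ℝ) 1, |R π| ≤ C)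
    (hRconv : ConvexOn ℝ (Icc (0:ℝ) 1) R)
    (hRδ : ∀ π ∈ Icc (0:ℝ) 1, δ ≤ R π)
    (V : ℝ → ℝ) (hVbd : ∃ C : ℝ, ∀ π ∈ Icc (0:ℝ) 1, |V π| ≤ C)
    (hV : ∀ π ∈ Icc (0:ℝ) 1,
      V π = max (R π + β * (π * V p + (1 - π) * V r)) (ω + β * V (Q π)))
    (hω : ω ≤ δ) :
    ∀ π ∈ Icc (0:ℝ) 1,
      ω + β * V (Q π) ≤ R π + β * (π * V p + (1 - π) * V r) := by
  intro x hx
  obtain ⟨C, hC⟩ := hVbd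
  obtain rfl : Q = fun x => x * p + (1 - x) * r := funext hQ
  have h := (convexOn_of_bellman hβ hp hr hRconv hC hV).2 hp hr hx.1 (sub_nonneg.2 hx.2)
    (by ring)
  exact add_le_add (hω.trans (hRδ x hx)) (mul_le_mul_of_nonneg_left h hβ.1)
end

section
/- Let β ∈ [0,1), ω ∈ ℝ, p, r ∈ [0,1], Q(x) = x·p + (1−x)·r, and let R : [0,1] → ℝ be bounded. Let V be a bounded solution of the Bellman equation V(π) = max{ R(π) + β·( π·V(p) + (1−π)·V(r) ), ω + β·V(Q(π)) }, and let I = [min{p,r}, max{p,r}]. If the idle branch attains the maximum at every π ∈ I, i.e., ω + β·V(Q(π)) ≥ R(π) + β·( π·V(p) + (1−π)·V(r) ) for all π ∈ I, then V(π) = ω/(1−β) for every π ∈ I; in particular V(p) = V(r) = ω/(1−β). -/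
open Set

/-- A bounded function satisfying `f x = ω + β * f (T x)` on a `T`-invariant set, with
`0 ≤ β < 1`, is constantly `ω / (1 - β)` there. -/
theorem eq_div_one_sub_of_eq_add_mul_comp {α : Type*} {s : Set α} {T : α → α} (hT : MapsTo T s s)
    {f : α → ℝ} {C : ℝ} (hf : ∀ x ∈ s, |f x| ≤ C) {β ω : ℝ} (hβ : β ∈ Ico (0 : ℝ) 1)
    (h : ∀ x ∈ s, f x = ω + β * f (T x)) {x : α} (hx : x ∈ s) : f x = ω / (1 - β) := by
  set c := ω / (1 - β) with hc
  have hfix : c = ω + β * c := by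
    have : 1 - β ≠ 0 := (sub_pos.2 hβ.2).ne'
    rw [hc]
    field_simp
    ring
  have hbound : ∀ n : ℕ, ∀ y ∈ s, |f y - c| ≤ β ^ n * (C + |c|) := by
    intro n
    induction n with
    | zero =>
      intro y hy
      simpa using (abs_sub _ _).trans (add_le_add_left (hf y hy) _)
    | succ n ih =>
      intro y hy
      have hstep : f y - c = β * (f (T y) - c) := by linear_combination h y hy - hfix
      rw [hstep, abs_mul, abs_of_nonneg hβ.1, pow_succ', mul_assoc]
      exact mul_le_mul_of_nonneg_left (ih _ (hT hy)) hβ.1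
  have hlim : Filter.Tendsto (fun n : ℕ => β ^ n * (C + |c|)) Filter.atTop (nhds 0) := by
    simpa using (tendsto_pow_atTop_nhds_zero_of_lt_one hβ.1 hβ.2).mul_const (C + |c|)
  have hle : |f x - c| ≤ 0 := ge_of_tendsto' hlim fun n => hbound n x hx
  exact sub_eq_zero.1 (abs_nonpos_iff.1 hle)

/-- If the idle branch attains the Bellman maximum throughout `[min{p,r}, max{p,r}]`,
then the value function is constantly `ω/(1-β)` there; in particular at `p` and `r`. -/
theorem stmt_14 (β ω : ℝ) (hβ : β ∈ Ico (0:ℝ) 1)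
    (p r : ℝ) (hp : p ∈ Icc (0:ℝ) 1) (hr : r ∈ Icc (0:ℝ) 1)
    (Q : ℝ → ℝ) (hQ : ∀ x, Q x = x * p + (1 - x) * r)
    (R : ℝ → ℝ) (hRbd : ∃ C : ℝ, ∀ π ∈ Icc (0:ℝ) 1, |R π| ≤ C)
    (V : ℝ → ℝ) (hVbd : ∃ C : ℝ, ∀ π ∈ Icc (0:ℝ) 1, |V π| ≤ C)
    (hV : ∀ π ∈ Icc (0:ℝ) 1,
      V π = max (R π + β * (π * V p + (1 - π) * V r)) (ω + β * V (Q π)))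
    (hidle : ∀ π ∈ Icc (min p r) (max p r),
      R π + β * (π * V p + (1 - π) * V r) ≤ ω + β * V (Q π)) :
    (∀ π ∈ Icc (min p r) (max p r), V π = ω / (1 - β)) ∧
    V p = ω / (1 - β) ∧ V r = ω / (1 - β) := by
  have hsub : Icc (min p r) (max p r) ⊆ Icc (0 : ℝ) 1 :=
    Icc_subset_Icc (le_min hp.1 hr.1) (max_le hp.2 hr.2)
  have hmaps : MapsTo Q (Icc (min p r) (max p r)) (Icc (min p r) (max p r)) := by
    intro x hx
    obtain ⟨h0, h1⟩ := hsub hx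
    rw [hQ]
    exact convex_Icc (min p r) (max p r) ⟨min_le_left _ _, le_max_left _ _⟩
      ⟨min_le_right _ _, le_max_right _ _⟩ h0 (sub_nonneg.2 h1) (add_sub_cancel _ _)
  obtain ⟨C, hC⟩ := hVbd
  have key : ∀ π ∈ Icc (min p r) (max p r), V π = ω / (1 - β) := fun π hπ =>
    eq_div_one_sub_of_eq_add_mul_comp hmaps (fun x hx => hC x (hsub hx)) hβ
      (fun x hx => (hV x (hsub hx)).trans (max_eq_right (hidle x hx))) hπ
  exact ⟨key, key p ⟨min_le_left _ _, le_max_left _ _⟩,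
    key r ⟨min_le_right _ _, le_max_right _ _⟩⟩
end

section
/- Let δ ∈ ℝ and, for each ω ∈ [δ, 1], let V⁰_ω, V¹_ω : [0,1] → ℝ be functions and π* : [δ,1] → [0,1] a threshold map such that (a) V¹_ω(π*(ω)) = V⁰_ω(π*(ω)) for every ω ∈ [δ,1], and (b) for every ω ∈ [δ,1] and π ∈ [0,1], if π ≥ π*(ω) then V¹_ω(π) ≥ V⁰_ω(π). Fix ω₀ ∈ [δ,1) and suppose there exists a sequence Δ_n → 0⁺ with ω₀ + Δ_n ∈ [δ,1] and π*(ω₀ + Δ_n) ≤ π*(ω₀) for all n. If the maps ω ↦ V¹_ω(π*(ω₀)) and ω ↦ V⁰_ω(π*(ω₀)) have right derivatives d¹ and d⁰ at ω₀, then d¹ ≥ d⁰. Consequently, if at every ω ∈ [δ,1] these right derivatives exist and satisfy d¹ < d⁰, then π* admits no such point of right non-increase: for every ω₀ ∈ [δ,1) there exists ε > 0 with π*(ω) > π*(ω₀) for all ω ∈ (ω₀, ω₀+ε] ∩ [δ,1]. -/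
open Set Filter Topology

/-- If `g` agrees with `f` at `a` and lies below `f` at points arbitrarily close to `a` on the
right, then the right derivative of `g` at `a` is at most that of `f`. -/
theorem HasDerivWithinAt.le_of_frequently_le_right {f g : ℝ → ℝ} {a f' g' : ℝ}
    (hf : HasDerivWithinAt f f' (Ici a) a) (hg : HasDerivWithinAt g g' (Ici a) a)
    (heq : f a = g a) (hle : ∃ᶠ x in 𝓝[>] a, g x ≤ f x) : g' ≤ f' := by
  have hs := (hasDerivWithinAt_iff_tendsto_slope' self_notMem_Ioi).1 (hf.sub hg).Ioi_of_Ici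
  refine sub_nonneg.1 (ge_of_tendsto_of_frequently hs ?_)
  refine (hle.and_eventually self_mem_nhdsWithin).mono fun x ⟨hx, hax⟩ => ?_
  rw [slope_def_field]
  have hax' : a < x := hax
  refine div_nonneg ?_ (by linarith)
  simp only [Pi.sub_apply]
  linarith

/-- Lemma 4 (Appendix B): comparison of right derivatives of the active and idle branch
values at the threshold rules out points of right non-increase of the threshold map;
consequently, if the active branch is everywhere less sensitive to the subsidy than the
idle branch (inequality (16)), the threshold is strictly right-increasing. -/
theorem stmt_16 (δ : ℝ) (V0 V1 : ℝ → ℝ → ℝ) (πs : ℝ → ℝ)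
    (hπs : ∀ ω ∈ Icc δ 1, πs ω ∈ Icc (0:ℝ) 1)
    (ha : ∀ ω ∈ Icc δ 1, V1 ω (πs ω) = V0 ω (πs ω))
    (hb : ∀ ω ∈ Icc δ 1, ∀ π ∈ Icc (0:ℝ) 1, πs ω ≤ π → V0 ω π ≤ V1 ω π) :
    (∀ ω₀ ∈ Ico δ 1, ∀ Δ : ℕ → ℝ,
      (∀ n, 0 < Δ n) → Tendsto Δ atTop (𝓝 0) →
      (∀ n, ω₀ + Δ n ∈ Icc δ 1) → (∀ n, πs (ω₀ + Δ n) ≤ πs ω₀) →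
      ∀ d1 d0 : ℝ,
        HasDerivWithinAt (fun ω => V1 ω (πs ω₀)) d1 (Ici ω₀) ω₀ →
        HasDerivWithinAt (fun ω => V0 ω (πs ω₀)) d0 (Ici ω₀) ω₀ →
        d0 ≤ d1) ∧
    ((∀ ω ∈ Icc δ 1, ∃ d1 d0 : ℝ,
        HasDerivWithinAt (fun ω' => V1 ω' (πs ω)) d1 (Ici ω) ω ∧
        HasDerivWithinAt (fun ω' => V0 ω' (πs ω)) d0 (Ici ω) ω ∧
        d1 < d0) →
      ∀ ω₀ ∈ Ico δ 1, ∃ ε > 0, ∀ ω ∈ Icc δ 1,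
        ω₀ < ω → ω ≤ ω₀ + ε → πs ω₀ < πs ω) := by
  have key : ∀ ω₀ ∈ Ico δ 1,
      (∃ᶠ ω in 𝓝[>] ω₀, ω ∈ Icc δ 1 ∧ πs ω ≤ πs ω₀) → ∀ d1 d0 : ℝ,
        HasDerivWithinAt (fun ω => V1 ω (πs ω₀)) d1 (Ici ω₀) ω₀ →
        HasDerivWithinAt (fun ω => V0 ω (πs ω₀)) d0 (Ici ω₀) ω₀ → d0 ≤ d1 := by
    intro ω₀ hω₀ hfreq d1 d0 h1 h0
    have hmem : ω₀ ∈ Icc δ 1 := Ico_subset_Icc_self hω₀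
    exact h1.le_of_frequently_le_right h0 (ha ω₀ hmem)
      (hfreq.mono fun ω h => hb ω h.1 _ (hπs ω₀ hmem) h.2)
  refine ⟨fun ω₀ hω₀ Δ hpos hlim hmem hle => key ω₀ hω₀ ?_, fun hd ω₀ hω₀ => ?_⟩
  · have ht : Tendsto (fun n => ω₀ + Δ n) atTop (𝓝[>] ω₀) :=
      tendsto_nhdsWithin_iff.2 ⟨by simpa using hlim.const_add ω₀,
        Eventually.of_forall fun n => lt_add_of_pos_right ω₀ (hpos n)⟩
    exact ht.frequently (Frequently.of_forall fun n => ⟨hmem n, hle n⟩)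
  · obtain ⟨d1, d0, h1, h0, hlt⟩ := hd ω₀ (Ico_subset_Icc_self hω₀)
    have hev := not_frequently.1 fun h => hlt.not_ge (key ω₀ hω₀ h d1 d0 h1 h0)
    obtain ⟨u, hu, hsub⟩ := mem_nhdsGT_iff_exists_Ioc_subset.1 hev
    refine ⟨u - ω₀, sub_pos.2 hu, fun ω hω hlo hhi => ?_⟩
    have hnot := hsub ⟨hlo, by linarith⟩
    exact lt_of_not_ge fun h => hnot ⟨hω, h⟩
end

section
/- Let β ∈ [0,1), δ ∈ [0,1), p, r ∈ [0,1] with p − r < 1, Q(x) = x·p + (1−x)·r, and let R : [0,1] → ℝ be convex and continuous with R(0) = δ, R(1) = 1 and max{δ, π} ≤ R(π) ≤ (1−δ)·π + δ for all π ∈ [0,1]. For each ω ∈ (δ,1), let V_ω be the unique bounded solution of the Bellman equation V_ω(π) = max{ R(π) + β·( π·V_ω(p) + (1−π)·V_ω(r) ), ω + β·V_ω(Q(π)) }, and define the threshold π*(ω) = inf{ π ∈ [0,1] : R(π) + β(π·V_ω(p) + (1−π)·V_ω(r)) ≥ ω + β·V_ω(Q(π)) }. Then ω ↦ π*(ω)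 is strictly increasing on (δ,1); i.e., the ω-subsidy problem is Whittle indexable. -/
open Set

/-- The belief after an idle decision. -/
def idleBelief (p r x : ℝ) : ℝ := x * p + (1 - x) * r

/-- `V` is a bounded solution on `[0, 1]` of the Bellman equation of the `ω`-subsidy problem. -/
structure IsSubsidyValue (β p r ω : ℝ) (R V : ℝ → ℝ) : Prop where
  bounded : ∃ C : ℝ, ∀ x ∈ Icc (0 : ℝ) 1, |V x| ≤ C
  bellman : ∀ x ∈ Icc (0 : ℝ) 1,
    V x = max (R x + β * (x * V p + (1 - x) * V r)) (ω + β * V (idleBelief p r x))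

/-- The payoff of the active branch minus the payoff of the idle branch. -/
def advantage (β p r ω : ℝ) (R V : ℝ → ℝ) (x : ℝ) : ℝ :=
  R x + β * (x * V p + (1 - x) * V r) - (ω + β * V (idleBelief p r x))

/-- The expected value of `f` after an observation minus its value after an idle decision. -/
def infoGain (p r : ℝ) (f : ℝ → ℝ) (x : ℝ) : ℝ :=
  x * f p + (1 - x) * f r - f (idleBelief p r x)

/-- A function bounded above is nonpositive if every nonnegative upper bound `K` of it can be
improved to `β * K`. -/
theorem nonpos_of_contracting_bound {α : Type*} {S : Set α} {f : α → ℝ} {β C : ℝ}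
    (hβ0 : 0 ≤ β) (hβ1 : β < 1) (hC : ∀ x ∈ S, f x ≤ C)
    (h : ∀ K, 0 ≤ K → (∀ x ∈ S, f x ≤ K) → ∀ x ∈ S, f x ≤ β * K) :
    ∀ x ∈ S, f x ≤ 0 := by
  have hn : ∀ n : ℕ, ∀ x ∈ S, f x ≤ β ^ n * |C| := by
    intro n
    induction n with
    | zero => intro x hx; simpa using (hC x hx).trans (le_abs_self C)
    | succ n ih =>
      intro x hx
      have := h _ (by positivity) ih x hx
      rwa [← mul_assoc, ← pow_succ'] at this
  intro x hx
  have hlim : Filter.Tendsto (fun n : ℕ => β ^ n * |C|) Filter.atTop (nhds 0) := by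
    simpa using (tendsto_pow_atTop_nhds_zero_of_lt_one hβ0 hβ1).mul_const |C|
  exact ge_of_tendsto' hlim fun n => hn n x hx

section Belief

variable {p r x y : ℝ}

theorem idleBelief_mem_Icc {a b : ℝ} (hp : p ∈ Icc a b) (hr : r ∈ Icc a b)
    (hx : x ∈ Icc (0 : ℝ) 1) : idleBelief p r x ∈ Icc a b := by
  obtain ⟨hx0, hx1⟩ := hx
  obtain ⟨hp0, hp1⟩ := hp
  obtain ⟨hr0, hr1⟩ := hr
  unfold idleBelief
  constructor <;> nlinarith

theorem idleBelief_sub (p r x y : ℝ) :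
    idleBelief p r x - idleBelief p r y = (p - r) * (x - y) := by
  unfold idleBelief; ring

theorem idleBelief_mono (h : r ≤ p) (hxy : x ≤ y) : idleBelief p r x ≤ idleBelief p r y := by
  have := idleBelief_sub p r y x
  nlinarith [mul_nonneg (sub_nonneg.2 h) (sub_nonneg.2 hxy)]

theorem abs_idleBelief_sub_le (hp : p ∈ Icc (0 : ℝ) 1) (hr : r ∈ Icc (0 : ℝ) 1) :
    |idleBelief p r x - idleBelief p r y| ≤ |x - y| := by
  rw [idleBelief_sub, abs_mul]
  have : |p - r| ≤ 1 := abs_le.2 ⟨by linarith [hp.1, hr.2], by linarith [hp.2, hr.1]⟩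
  nlinarith [abs_nonneg (x - y)]

theorem infoGain_nonneg_of_convexOn {f : ℝ → ℝ} (hf : ConvexOn ℝ (Icc (0 : ℝ) 1) f)
    (hp : p ∈ Icc (0 : ℝ) 1) (hr : r ∈ Icc (0 : ℝ) 1) (hx : x ∈ Icc (0 : ℝ) 1) :
    0 ≤ infoGain p r f x := by
  have := hf.2 hp hr hx.1 (sub_nonneg.2 hx.2) (by ring)
  simp only [smul_eq_mul] at this
  unfold infoGain idleBelief
  linarith

end Belief

section Reward

variable {R : ℝ → ℝ}

theorem monotoneOn_of_convexOn_of_left_le (hR : ConvexOn ℝ (Icc (0 : ℝ) 1) R)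
    (h0 : ∀ x ∈ Icc (0 : ℝ) 1, R 0 ≤ R x) : MonotoneOn R (Icc (0 : ℝ) 1) := by
  intro x hx y hy hxy
  rcases hy.1.eq_or_lt with h | h
  · have : x = y := le_antisymm hxy (h ▸ hx.1)
    rw [this]
  have ht0 : 0 ≤ x / y := div_nonneg hx.1 h.le
  have ht1 : 0 ≤ 1 - x / y := sub_nonneg.2 ((div_le_one h).2 hxy)
  have key := hR.2 hy (left_mem_Icc.2 zero_le_one) ht0 ht1 (by ring)
  have hxy' : x / y * y = x := div_mul_cancel₀ x h.ne'
  simp only [smul_eq_mul, mul_zero, add_zero, hxy'] at key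
  nlinarith [mul_nonneg ht1 (sub_nonneg.2 (h0 y hy))]

theorem sub_le_sub_of_convexOn (hR : ConvexOn ℝ (Icc (0 : ℝ) 1) R) (hR1 : R 1 = 1)
    (hid : ∀ x ∈ Icc (0 : ℝ) 1, x ≤ R x) {x y : ℝ} (hx : x ∈ Icc (0 : ℝ) 1)
    (hy : y ∈ Icc (0 : ℝ) 1) (hxy : x ≤ y) : R y - R x ≤ y - x := by
  rcases hx.2.eq_or_lt with h | h
  · have : y = x := le_antisymm (h ▸ hy.2) hxy
    simp [this]
  have h' : 0 < 1 - x := sub_pos.2 h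
  have ht0 : 0 ≤ (y - x) / (1 - x) := div_nonneg (sub_nonneg.2 hxy) h'.le
  have ht1 : 0 ≤ 1 - (y - x) / (1 - x) :=
    sub_nonneg.2 ((div_le_one h').2 (by linarith [hy.2]))
  have hmul : (y - x) / (1 - x) * (1 - x) = y - x := div_mul_cancel₀ _ h'.ne'
  have key := hR.2 (right_mem_Icc.2 zero_le_one) hx ht0 ht1 (by ring)
  have harg : (y - x) / (1 - x) * 1 + (1 - (y - x) / (1 - x)) * x = y := by linarith
  simp only [smul_eq_mul, harg, hR1] at key
  nlinarith [mul_nonneg ht0 (sub_nonneg.2 (hid x hx))]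

end Reward

namespace IsSubsidyValue

variable {β p r ω : ℝ} {R V : ℝ → ℝ}

theorem active_le (hV : IsSubsidyValue β p r ω R V) {x : ℝ} (hx : x ∈ Icc (0 : ℝ) 1) :
    R x + β * (x * V p + (1 - x) * V r) ≤ V x :=
  (hV.bellman x hx).symm ▸ le_max_left _ _

theorem idle_le (hV : IsSubsidyValue β p r ω R V) {x : ℝ} (hx : x ∈ Icc (0 : ℝ) 1) :
    ω + β * V (idleBelief p r x) ≤ V x :=
  (hV.bellman x hx).symm ▸ le_max_right _ _

theorem eq_active (hV : IsSubsidyValue β p r ω R V) {x : ℝ} (hx : x ∈ Icc (0 : ℝ) 1)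
    (h : 0 ≤ advantage β p r ω R V x) : V x = R x + β * (x * V p + (1 - x) * V r) :=
  (hV.bellman x hx).trans (max_eq_left (sub_nonneg.1 h))

theorem eq_idle (hV : IsSubsidyValue β p r ω R V) {x : ℝ} (hx : x ∈ Icc (0 : ℝ) 1)
    (h : advantage β p r ω R V x ≤ 0) : V x = ω + β * V (idleBelief p r x) :=
  (hV.bellman x hx).trans (max_eq_right (sub_nonpos.1 h))

theorem const_le (hV : IsSubsidyValue β p r ω R V) (hβ0 : 0 ≤ β) (hβ1 : β < 1)
    (hp : p ∈ Icc (0 : ℝ) 1) (hr : r ∈ Icc (0 : ℝ) 1) {x : ℝ} (hx : x ∈ Icc (0 : ℝ) 1) :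
    ω / (1 - β) ≤ V x := by
  obtain ⟨C, hC⟩ := hV.bounded
  have hc : ω / (1 - β) * (1 - β) = ω := div_mul_cancel₀ _ (sub_pos.2 hβ1).ne'
  have key := nonpos_of_contracting_bound (S := Icc (0 : ℝ) 1)
    (f := fun y => ω / (1 - β) - V y) (C := ω / (1 - β) + C) hβ0 hβ1
    (fun y hy => by linarith [(abs_le.1 (hC y hy)).1]) (by
      intro K _ h y hy
      have h1 := hV.idle_le hy
      have h2 := mul_le_mul_of_nonneg_left (h _ (idleBelief_mem_Icc hp hr hy)) hβ0
      linarith)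
  exact sub_nonpos.1 (key x hx)

theorem eq_const_of_le (hV : IsSubsidyValue β p r ω R V) (hβ0 : 0 ≤ β) (hβ1 : β < 1)
    (hp : p ∈ Icc (0 : ℝ) 1) (hr : r ∈ Icc (0 : ℝ) 1) {S : Set ℝ} (hS : S ⊆ Icc (0 : ℝ) 1)
    (h : ∀ K, 0 ≤ K → (∀ x ∈ S, V x - ω / (1 - β) ≤ K) → ∀ x ∈ S, V x - ω / (1 - β) ≤ β * K)
    {x : ℝ} (hx : x ∈ S) : V x = ω / (1 - β) := by
  obtain ⟨C, hC⟩ := hV.bounded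
  have key := nonpos_of_contracting_bound (C := C - ω / (1 - β)) hβ0 hβ1
    (fun y hy => by linarith [(abs_le.1 (hC y (hS hy))).2]) h
  exact le_antisymm (sub_nonpos.1 (key x hx)) (hV.const_le hβ0 hβ1 hp hr (hS hx))

theorem eq_const_of_idle (hV : IsSubsidyValue β p r ω R V) (hβ0 : 0 ≤ β) (hβ1 : β < 1)
    (hp : p ∈ Icc (0 : ℝ) 1) (hr : r ∈ Icc (0 : ℝ) 1) {S : Set ℝ} (hS : S ⊆ Icc (0 : ℝ) 1)
    (hQ : ∀ x ∈ S, idleBelief p r x ∈ S)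
    (h : ∀ x ∈ S, V x = ω + β * V (idleBelief p r x)) {x : ℝ} (hx : x ∈ S) :
    V x = ω / (1 - β) := by
  have hc : ω / (1 - β) * (1 - β) = ω := div_mul_cancel₀ _ (sub_pos.2 hβ1).ne'
  refine hV.eq_const_of_le hβ0 hβ1 hp hr hS (fun K _ hK y hy => ?_) hx
  have h2 := mul_le_mul_of_nonneg_left (hK _ (hQ y hy)) hβ0
  linarith [h y hy]

theorem eq_const_of_reward_le (hV : IsSubsidyValue β p r ω R V) (hβ0 : 0 ≤ β) (hβ1 : β < 1)
    {m : ℝ} (hm : m ≤ 1) (hp : p ∈ Icc 0 m) (hr : r ∈ Icc 0 m)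
    (hR : ∀ x ∈ Icc 0 m, R x ≤ ω) {x : ℝ} (hx : x ∈ Icc 0 m) : V x = ω / (1 - β) := by
  have hS : Icc 0 m ⊆ Icc (0 : ℝ) 1 := Icc_subset_Icc_right hm
  have hc : ω / (1 - β) * (1 - β) = ω := div_mul_cancel₀ _ (sub_pos.2 hβ1).ne'
  refine hV.eq_const_of_le hβ0 hβ1 (hS hp) (hS hr) hS (fun K _ hK y hy => ?_) hx
  have h1 := mul_le_mul_of_nonneg_left (hK _ (idleBelief_mem_Icc hp hr (hS hy))) hβ0
  have h2 := mul_le_mul_of_nonneg_left (hK p hp) (hS hy).1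
  have h3 := mul_le_mul_of_nonneg_left (hK r hr) (sub_nonneg.2 (hS hy).2)
  have h4 := mul_le_mul_of_nonneg_left (add_le_add h2 h3) hβ0
  rw [sub_le_iff_le_add, hV.bellman y (hS hy)]
  refine max_le ?_ ?_
  · linarith [hR y hy]
  · linarith

theorem convexOn (hV : IsSubsidyValue β p r ω R V) (hβ0 : 0 ≤ β) (hβ1 : β < 1)
    (hp : p ∈ Icc (0 : ℝ) 1) (hr : r ∈ Icc (0 : ℝ) 1) (hR : ConvexOn ℝ (Icc (0 : ℝ) 1) R) :
    ConvexOn ℝ (Icc (0 : ℝ) 1) V := by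
  obtain ⟨C, hC⟩ := hV.bounded
  have hmem : ∀ x ∈ Icc (0 : ℝ) 1, ∀ y ∈ Icc (0 : ℝ) 1, ∀ t ∈ Icc (0 : ℝ) 1,
      t * x + (1 - t) * y ∈ Icc (0 : ℝ) 1 := fun x hx y hy t ht =>
    idleBelief_mem_Icc hx hy ht
  have key := nonpos_of_contracting_bound
    (S := {z : ℝ × ℝ × ℝ | z.1 ∈ Icc (0 : ℝ) 1 ∧ z.2.1 ∈ Icc (0 : ℝ) 1 ∧ z.2.2 ∈ Icc (0 : ℝ) 1})
    (f := fun z => V (z.2.2 * z.1 + (1 - z.2.2) * z.2.1) - z.2.2 * V z.1 - (1 - z.2.2) * V z.2.1)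
    (C := 2 * C) hβ0 hβ1 (by
      rintro ⟨x, y, t⟩ ⟨hx, hy, ht⟩
      dsimp only at hx hy ht ⊢
      have h1 := (abs_le.1 (hC _ (hmem x hx y hy t ht))).2
      have h2 := mul_le_mul_of_nonneg_left (abs_le.1 (hC x hx)).1 ht.1
      have h3 := mul_le_mul_of_nonneg_left (abs_le.1 (hC y hy)).1 (sub_nonneg.2 ht.2)
      linarith) (by
      rintro K hK h ⟨x, y, t⟩ ⟨hx, hy, ht⟩
      dsimp only at hx hy ht ⊢
      have ht' := sub_nonneg.2 ht.2
      have hQ : idleBelief p r (t * x + (1 - t) * y)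
          = t * idleBelief p r x + (1 - t) * idleBelief p r y := by
        unfold idleBelief; ring
      have h1 := mul_le_mul_of_nonneg_left (h (idleBelief p r x, idleBelief p r y, t)
        ⟨idleBelief_mem_Icc hp hr hx, idleBelief_mem_Icc hp hr hy, ht⟩) hβ0
      dsimp only at h1
      have hax := mul_le_mul_of_nonneg_left (hV.active_le hx) ht.1
      have hay := mul_le_mul_of_nonneg_left (hV.active_le hy) ht'
      have hix := mul_le_mul_of_nonneg_left (hV.idle_le hx) ht.1
      have hiy := mul_le_mul_of_nonneg_left (hV.idle_le hy) ht'
      have hRc := hR.2 hx hy ht.1 ht' (by ring)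
      simp only [smul_eq_mul] at hRc
      have hβK := mul_nonneg hβ0 hK
      rw [sub_sub, sub_le_iff_le_add, hV.bellman _ (hmem x hx y hy t ht), hQ]
      refine max_le ?_ ?_
      · linarith
      · linarith)
  refine ⟨convex_Icc 0 1, fun x hx y hy a b ha hb hab => ?_⟩
  obtain rfl : b = 1 - a := by linarith
  have := key (x, y, a) ⟨hx, hy, ha, by linarith⟩
  simp only [smul_eq_mul]
  dsimp only at this
  linarith

theorem continuousOn (hV : IsSubsidyValue β p r ω R V) (hβ0 : 0 ≤ β) (hβ1 : β < 1)
    (hp : p ∈ Icc (0 : ℝ) 1) (hr : r ∈ Icc (0 : ℝ) 1)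
    (hR : ∀ x ∈ Icc (0 : ℝ) 1, ∀ y ∈ Icc (0 : ℝ) 1, |R x - R y| ≤ |x - y|) :
    ContinuousOn V (Icc (0 : ℝ) 1) := by
  obtain ⟨C, hC⟩ := hV.bounded
  set L := (1 + β * |V p - V r|) / (1 - β) with hL
  have hL0 : 0 ≤ L := div_nonneg (by positivity) (sub_pos.2 hβ1).le
  have hLeq : L * (1 - β) = 1 + β * |V p - V r| := div_mul_cancel₀ _ (sub_pos.2 hβ1).ne'
  have key := nonpos_of_contracting_bound (S := Icc (0 : ℝ) 1 ×ˢ Icc (0 : ℝ) 1)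
    (f := fun z => V z.1 - V z.2 - L * |z.1 - z.2|) (C := 2 * C) hβ0 hβ1 (by
      rintro ⟨x, y⟩ ⟨hx, hy⟩
      dsimp only at hx hy ⊢
      have := mul_nonneg hL0 (abs_nonneg (x - y))
      linarith [(abs_le.1 (hC x hx)).2, (abs_le.1 (hC y hy)).1]) (by
      rintro K hK h ⟨x, y⟩ ⟨hx, hy⟩
      dsimp only at hx hy ⊢
      have hβK := mul_nonneg hβ0 hK
      have hd := abs_nonneg (x - y)
      have h1 := mul_le_mul_of_nonneg_left (h (idleBelief p r x, idleBelief p r y)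
        ⟨idleBelief_mem_Icc hp hr hx, idleBelief_mem_Icc hp hr hy⟩) hβ0
      dsimp only at h1
      have h2 := mul_le_mul_of_nonneg_left
        (abs_idleBelief_sub_le (x := x) (y := y) hp hr) (mul_nonneg hβ0 hL0)
      have h3 : (x - y) * (V p - V r) ≤ |x - y| * |V p - V r| :=
        (le_abs_self _).trans (abs_mul _ _).le
      have h4 := mul_le_mul_of_nonneg_left h3 hβ0
      have h5 := (le_abs_self _).trans (hR x hx y hy)
      have h6 : L * |x - y| = |x - y| + β * (|x - y| * |V p - V r|) + β * L * |x - y| := by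
        linear_combination |x - y| * hLeq
      have h7 : 0 ≤ β * L * |x - y| := by positivity
      have h8 : 0 ≤ β * (|x - y| * |V p - V r|) := by positivity
      rw [sub_sub, sub_le_iff_le_add, hV.bellman x hx]
      refine max_le ?_ ?_
      · linarith [hV.active_le hy]
      · linarith [hV.idle_le hy])
  have hlip : LipschitzOnWith L.toNNReal V (Icc (0 : ℝ) 1) := by
    refine LipschitzOnWith.of_le_add_mul _ fun x hx y hy => ?_
    have := key (x, y) ⟨hx, hy⟩
    dsimp only at this
    rw [Real.dist_eq, Real.coe_toNNReal L hL0]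
    linarith
  exact hlip.continuousOn

theorem continuousOn_advantage (hV : IsSubsidyValue β p r ω R V) (hβ0 : 0 ≤ β) (hβ1 : β < 1)
    (hp : p ∈ Icc (0 : ℝ) 1) (hr : r ∈ Icc (0 : ℝ) 1)
    (hR : ∀ x ∈ Icc (0 : ℝ) 1, ∀ y ∈ Icc (0 : ℝ) 1, |R x - R y| ≤ |x - y|)
    (hRc : ContinuousOn R (Icc (0 : ℝ) 1)) :
    ContinuousOn (advantage β p r ω R V) (Icc (0 : ℝ) 1) := by
  have hQ : ContinuousOn (fun x => V (idleBelief p r x)) (Icc (0 : ℝ) 1) :=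
    (hV.continuousOn hβ0 hβ1 hp hr hR).comp
      (by unfold idleBelief; fun_prop) (fun x hx => idleBelief_mem_Icc hp hr hx)
  exact (hRc.add (Continuous.continuousOn (by fun_prop))).sub
    (continuousOn_const.add (continuousOn_const.mul hQ))

end IsSubsidyValue

section Advantage

theorem advantage_eq_add_infoGain (β p r ω : ℝ) (R V : ℝ → ℝ) (x : ℝ) :
    advantage β p r ω R V x = R x - ω + β * infoGain p r V x := by
  unfold advantage infoGain; ring

theorem advantage_sub_advantage (β p r ω ω' : ℝ) (R V V' : ℝ → ℝ) (x : ℝ) :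
    advantage β p r ω' R V' x - advantage β p r ω R V x
      = β * infoGain p r (fun y => V' y - V y) x - (ω' - ω) := by
  unfold advantage infoGain; ring

end Advantage

namespace IsSubsidyValue

variable {β p r ω ω' : ℝ} {R V V' : ℝ → ℝ}

theorem le_advantage (hV : IsSubsidyValue β p r ω R V) (hβ0 : 0 ≤ β) (hβ1 : β < 1)
    (hp : p ∈ Icc (0 : ℝ) 1) (hr : r ∈ Icc (0 : ℝ) 1) (hR : ConvexOn ℝ (Icc (0 : ℝ) 1) R)
    {x : ℝ} (hx : x ∈ Icc (0 : ℝ) 1) : R x - ω ≤ advantage β p r ω R V x := by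
  rw [advantage_eq_add_infoGain]
  have := mul_nonneg hβ0
    (infoGain_nonneg_of_convexOn (hV.convexOn hβ0 hβ1 hp hr hR) hp hr hx)
  linarith

theorem sub_le_max (hV : IsSubsidyValue β p r ω R V) (hV' : IsSubsidyValue β p r ω' R V')
    {x : ℝ} (hx : x ∈ Icc (0 : ℝ) 1) :
    V' x - V x ≤ max (β * (x * (V' p - V p) + (1 - x) * (V' r - V r)))
      (ω' - ω + β * (V' (idleBelief p r x) - V (idleBelief p r x))) := by
  rw [hV'.bellman x hx, sub_le_iff_le_add]
  refine max_le ?_ ?_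
  · linarith [hV.active_le hx, le_max_left (β * (x * (V' p - V p) + (1 - x) * (V' r - V r)))
      (ω' - ω + β * (V' (idleBelief p r x) - V (idleBelief p r x)))]
  · linarith [hV.idle_le hx, le_max_right (β * (x * (V' p - V p) + (1 - x) * (V' r - V r)))
      (ω' - ω + β * (V' (idleBelief p r x) - V (idleBelief p r x)))]

theorem min_le_sub (hV : IsSubsidyValue β p r ω R V) (hV' : IsSubsidyValue β p r ω' R V')
    {x : ℝ} (hx : x ∈ Icc (0 : ℝ) 1) :
    min (β * (x * (V' p - V p) + (1 - x) * (V' r - V r)))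
      (ω' - ω + β * (V' (idleBelief p r x) - V (idleBelief p r x))) ≤ V' x - V x := by
  have h := hV'.sub_le_max hV hx
  rw [min_le_iff]
  rcases le_max_iff.1 h with h | h
  · left; linarith
  · right; linarith

theorem sub_le_const (hV : IsSubsidyValue β p r ω R V) (hV' : IsSubsidyValue β p r ω' R V')
    (hβ0 : 0 ≤ β) (hβ1 : β < 1) (hp : p ∈ Icc (0 : ℝ) 1) (hr : r ∈ Icc (0 : ℝ) 1)
    (hω : ω ≤ ω') {x : ℝ} (hx : x ∈ Icc (0 : ℝ) 1) : V' x - V x ≤ (ω' - ω) / (1 - β) := by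
  obtain ⟨C, hC⟩ := hV.bounded
  obtain ⟨C', hC'⟩ := hV'.bounded
  have hc : (ω' - ω) / (1 - β) * (1 - β) = ω' - ω := div_mul_cancel₀ _ (sub_pos.2 hβ1).ne'
  have key := nonpos_of_contracting_bound (S := Icc (0 : ℝ) 1)
    (f := fun y => V' y - V y - (ω' - ω) / (1 - β)) (C := C' + C - (ω' - ω) / (1 - β)) hβ0 hβ1
    (fun y hy => by linarith [(abs_le.1 (hC' y hy)).2, (abs_le.1 (hC y hy)).1]) (by
      intro K _ h y hy
      have h1 := mul_le_mul_of_nonneg_left (h _ (idleBelief_mem_Icc hp hr hy)) hβ0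
      have h2 := mul_le_mul_of_nonneg_left (h p hp) hy.1
      have h3 := mul_le_mul_of_nonneg_left (h r hr) (sub_nonneg.2 hy.2)
      have h4 := mul_le_mul_of_nonneg_left (add_le_add h2 h3) hβ0
      rw [sub_le_iff_le_add]
      refine (hV.sub_le_max hV' hy).trans (max_le ?_ ?_)
      · linarith
      · linarith)
  exact sub_nonpos.1 (key x hx)

/-- If the larger subsidy makes idling forever optimal at every belief reachable in one step
from `x`, then the advantage of being active at `x` decreases with the subsidy. -/
theorem advantage_lt_of_eq_const (hV : IsSubsidyValue β p r ω R V) (hβ0 : 0 ≤ β) (hβ1 : β < 1)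
    (hp : p ∈ Icc (0 : ℝ) 1) (hr : r ∈ Icc (0 : ℝ) 1) (hR : ConvexOn ℝ (Icc (0 : ℝ) 1) R)
    (hω : ω < ω') {c x : ℝ} (hx : x ∈ Icc (0 : ℝ) 1) (hVp : V' p = c) (hVr : V' r = c)
    (hVx : V' (idleBelief p r x) = c) :
    advantage β p r ω' R V' x < advantage β p r ω R V x := by
  have h := mul_nonneg hβ0
    (infoGain_nonneg_of_convexOn (hV.convexOn hβ0 hβ1 hp hr hR) hp hr hx)
  rw [advantage_eq_add_infoGain, advantage_eq_add_infoGain]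
  have h' : infoGain p r V' x = 0 := by
    rw [infoGain, hVp, hVr, hVx]; ring
  rw [h']
  linarith

theorem infoGain_sub_le (hV : IsSubsidyValue β p r ω R V) (hV' : IsSubsidyValue β p r ω' R V')
    (hp : p ∈ Icc (0 : ℝ) 1) (hr : r ∈ Icc (0 : ℝ) 1)
    (hΔr : V' r - V r = β * (r * (V' p - V p) + (1 - r) * (V' r - V r)))
    {x : ℝ} (hx : x ∈ Icc (0 : ℝ) 1) :
    infoGain p r (fun y => V' y - V y) x ≤
      x * (V' p - V p - β * (p * (V' p - V p) + (1 - p) * (V' r - V r))) +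
        max 0 (β * infoGain p r (fun y => V' y - V y) (idleBelief p r x) - (ω' - ω)) := by
  have h := hV.min_le_sub hV' (idleBelief_mem_Icc hp hr hx)
  have hid : infoGain p r (fun y => V' y - V y) x =
      x * (V' p - V p - β * (p * (V' p - V p) + (1 - p) * (V' r - V r))) +
      (β * (idleBelief p r x * (V' p - V p) + (1 - idleBelief p r x) * (V' r - V r)) -
        (V' (idleBelief p r x) - V (idleBelief p r x))) := by
    unfold infoGain idleBelief
    linear_combination (1 - x) * hΔr
  rw [hid]
  refine add_le_add_right ?_ _
  rw [infoGain, le_max_iff]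
  rcases min_le_iff.1 h with h | h
  · left; linarith
  · right; linarith

/-- An upper bound on the change of the value difference gives a bound on the information gain. -/
theorem mul_infoGain_sub_lt (hV : IsSubsidyValue β p r ω R V)
    (hV' : IsSubsidyValue β p r ω' R V')
    (hβ0 : 0 ≤ β) (hβ1 : β < 1) (hp : p ∈ Icc (0 : ℝ) 1) (hr : r ∈ Icc (0 : ℝ) 1) (hω : ω < ω')
    (hΔr : V' r - V r = β * (r * (V' p - V p) + (1 - r) * (V' r - V r)))
    (hX : V' p - V p - β * (p * (V' p - V p) + (1 - p) * (V' r - V r)) ≤ ω' - ω)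
    {x : ℝ} (hx : x ∈ Icc (0 : ℝ) 1) :
    β * infoGain p r (fun y => V' y - V y) x < ω' - ω := by
  obtain ⟨C, hC⟩ := hV.bounded
  obtain ⟨C', hC'⟩ := hV'.bounded
  have hΔ : ∀ y ∈ Icc (0 : ℝ) 1, |V' y - V y| ≤ C' + C := fun y hy =>
    (abs_sub _ _).trans (add_le_add (hC' y hy) (hC y hy))
  have hε : 0 < ω' - ω := sub_pos.2 hω
  have key := nonpos_of_contracting_bound (S := Icc (0 : ℝ) 1)
    (f := fun y => infoGain p r (fun y => V' y - V y) y - (ω' - ω)) (C := 2 * (C' + C)) hβ0 hβ1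
    (fun y hy => by
      have h1 := mul_le_mul_of_nonneg_left (abs_le.1 (hΔ p hp)).2 hy.1
      have h2 := mul_le_mul_of_nonneg_left (abs_le.1 (hΔ r hr)).2 (sub_nonneg.2 hy.2)
      have h3 := (abs_le.1 (hΔ _ (idleBelief_mem_Icc hp hr hy))).1
      unfold infoGain
      linarith) (by
      intro K hK h y hy
      have h1 := hV.infoGain_sub_le hV' hp hr hΔr hy
      have h2 := mul_le_mul_of_nonneg_left hX hy.1
      have h3 := mul_le_mul_of_nonneg_left (h _ (idleBelief_mem_Icc hp hr hy)) hβ0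
      have h4 := mul_le_mul_of_nonneg_right hy.2 hε.le
      have h5 := mul_le_mul_of_nonneg_right hβ1.le hε.le
      have h6 : max 0 (β * infoGain p r (fun y => V' y - V y) (idleBelief p r y) - (ω' - ω))
          ≤ β * K := max_le (mul_nonneg hβ0 hK) (by linarith)
      linarith)
  have h1 := mul_le_mul_of_nonneg_left (sub_nonpos.1 (key x hx)) hβ0
  have h2 := mul_lt_mul_of_pos_right hβ1 hε
  linarith

theorem mul_infoGain_sub_lt_of_eq_const (hV : IsSubsidyValue β p r ω R V)
    (hV' : IsSubsidyValue β p r ω' R V')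
    (hβ0 : 0 ≤ β) (hβ1 : β < 1) (hp : p ∈ Icc (0 : ℝ) 1) (hr : r ∈ Icc (0 : ℝ) 1)
    (hR : ConvexOn ℝ (Icc (0 : ℝ) 1) R) (hω : ω < ω') (hpr : p ≤ r)
    (hΔr : V' r - V r = β * (r * (V' p - V p) + (1 - r) * (V' r - V r)))
    (hn : infoGain p r (fun y => V' y - V y) p < 0) {c : ℝ}
    (hc : ∀ y ∈ Icc p (idleBelief p r p), V' y = c)
    {x : ℝ} (hx : x ∈ Icc (0 : ℝ) 1) :
    β * infoGain p r (fun y => V' y - V y) x < ω' - ω := by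
  have hε : 0 < ω' - ω := sub_pos.2 hω
  have hp1 : p < 1 := by
    refine lt_of_le_of_ne hp.2 fun h => hn.ne ?_
    unfold infoGain idleBelief
    rw [h]
    norm_num
  have hconv := hV.convexOn hβ0 hβ1 hp hr hR
  have hQp : idleBelief p r p ∈ Icc p r :=
    idleBelief_mem_Icc (left_mem_Icc.2 hpr) (right_mem_Icc.2 hpr) hp
  have hlow : ∀ y ∈ Icc p 1, infoGain p r (fun y => V' y - V y) y ≤ 0 := by
    intro y hy
    have h1p : 0 < 1 - p := sub_pos.2 hp1
    set t := (y - p) / (1 - p) with ht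
    have ht0 : 0 ≤ t := div_nonneg (sub_nonneg.2 hy.1) h1p.le
    have ht1 : 0 ≤ 1 - t := sub_nonneg.2 ((div_le_one h1p).2 (by linarith [hy.2]))
    have hty : t * (1 - p) = y - p := div_mul_cancel₀ _ h1p.ne'
    have hQ : idleBelief p r y = t * p + (1 - t) * idleBelief p r p := by
      unfold idleBelief
      linear_combination (r - p) * hty
    have hQm : idleBelief p r y ∈ Icc p (idleBelief p r p) := by
      rw [hQ]
      exact idleBelief_mem_Icc (left_mem_Icc.2 hQp.1) (right_mem_Icc.2 hQp.1)
        ⟨ht0, sub_nonneg.1 ht1⟩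
    have hcv := hconv.2 hp (idleBelief_mem_Icc hp hr hp) ht0 ht1 (by ring)
    simp only [smul_eq_mul, ← hQ] at hcv
    have h1 := hc _ hQm
    have h2 := hc _ (left_mem_Icc.2 hQp.1)
    have h3 := hc _ (right_mem_Icc.2 hQp.1)
    have h4 := mul_nonneg ht1 (neg_nonneg.2 hn.le)
    have hy' : y = t * (1 - p) + p := by linarith
    simp only [infoGain] at h4 ⊢
    rw [h3] at h4
    rw [h1]
    have h5 : y * (V' p - V p) + (1 - y) * (V' r - V r) =
        t * (V' p - V p) + (1 - t) * (p * (V' p - V p) + (1 - p) * (V' r - V r)) := by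
      rw [hy']; ring
    rw [h5]
    rw [h2] at h4 ⊢
    linarith
  rcases le_or_gt p x with h | h
  · have := mul_nonneg hβ0 (neg_nonneg.2 (hlow x ⟨h, hx.2⟩))
    linarith
  have hstep := hV.infoGain_sub_le hV' hp hr hΔr hx
  have hQx : idleBelief p r x ∈ Icc p 1 :=
    idleBelief_mem_Icc (left_mem_Icc.2 hp.2) ⟨hpr, hr.2⟩ hx
  have hmax : max 0 (β * infoGain p r (fun y => V' y - V y) (idleBelief p r x) - (ω' - ω)) = 0 :=
    max_eq_left (by linarith [mul_nonneg hβ0 (neg_nonneg.2 (hlow _ hQx))])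
  rw [hmax, add_zero] at hstep
  set a := V' p - V p with ha
  set b := V' r - V r with hb
  set X := a - β * (p * a + (1 - p) * b) with hX
  have hβstep := mul_le_mul_of_nonneg_left hstep hβ0
  rcases le_or_gt X 0 with hX0 | hX0
  · have := mul_nonneg hβ0 (mul_nonneg hx.1 (neg_nonneg.2 hX0))
    linarith
  have hab : a * (1 - β) ≤ ω' - ω :=
    (le_div_iff₀ (sub_pos.2 hβ1)).1 (hV.sub_le_const hV' hβ0 hβ1 hp hr hω.le hp)
  have hden : 0 < 1 - β + β * r := by linarith [mul_nonneg hβ0 hr.1]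
  have hXeq : X * (1 - β + β * r) = a * (1 - β) * (1 + β * (r - p)) := by
    rw [hX]
    linear_combination (-β * (1 - p)) * hΔr
  have hfac : 0 ≤ 1 + β * (r - p) := by linarith [mul_nonneg hβ0 (sub_nonneg.2 hpr)]
  have hXle : X * (1 - β + β * r) ≤ (ω' - ω) * (1 + β * (r - p)) :=
    hXeq.trans_le (mul_le_mul_of_nonneg_right hab hfac)
  have hβp : β * p * (1 + β * (r - p)) < 1 - β + β * r := by
    have h1 : β * p ≤ 1 := mul_le_one₀ hβ1.le hp.1 hp.2
    have h2 := mul_le_mul_of_nonneg_right h1 (mul_nonneg hβ0 (sub_nonneg.2 hpr))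
    linarith
  have hfin : (β * p * X) * (1 - β + β * r) < (ω' - ω) * (1 - β + β * r) := by
    have h1 := mul_le_mul_of_nonneg_left hXle (mul_nonneg hβ0 hp.1)
    have h2 := mul_lt_mul_of_pos_left hβp hε
    linarith
  have hfin' := lt_of_mul_lt_mul_right hfin hden.le
  have hxp := mul_le_mul_of_nonneg_left (mul_le_mul_of_nonneg_right h.le hX0.le) hβ0
  linarith

/-- If idling is optimal at `p` and at the belief that follows it, then convexity makes idling
forever optimal between these two beliefs. -/
theorem eq_const_of_idle_idle (hV : IsSubsidyValue β p r ω R V) (hβ0 : 0 ≤ β) (hβ1 : β < 1)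
    (hp : p ∈ Icc (0 : ℝ) 1) (hr : r ∈ Icc (0 : ℝ) 1) (hR : ConvexOn ℝ (Icc (0 : ℝ) 1) R)
    (hpr : p ≤ r) (hDp : advantage β p r ω R V p ≤ 0)
    (hDz : advantage β p r ω R V (idleBelief p r p) ≤ 0) :
    ∀ y ∈ Icc p (idleBelief p r p), V y = ω / (1 - β) := by
  have hconv := hV.convexOn hβ0 hβ1 hp hr hR
  have hc : ω / (1 - β) * (1 - β) = ω := div_mul_cancel₀ _ (sub_pos.2 hβ1).ne'
  set z := idleBelief p r p with hz
  have hzm : z ∈ Icc (0 : ℝ) 1 := idleBelief_mem_Icc hp hr hp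
  have hpz : p ≤ z := (idleBelief_mem_Icc (left_mem_Icc.2 hpr) (right_mem_Icc.2 hpr) hp).1
  have hw : idleBelief p r z ∈ Icc p z := by
    refine ⟨(idleBelief_mem_Icc (left_mem_Icc.2 hpr) (right_mem_Icc.2 hpr) hzm).1, ?_⟩
    have h1 := idleBelief_sub p r z p
    linarith [mul_nonneg (sub_nonneg.2 hpr) (sub_nonneg.2 hpz)]
  have hwm : idleBelief p r z ∈ Icc (0 : ℝ) 1 := idleBelief_mem_Icc hp hr hzm
  have h1 := hV.eq_idle hp hDp
  have h2 := hV.eq_idle hzm hDz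
  rw [← hz] at h1
  have hlow := hV.const_le hβ0 hβ1 hp hr hwm
  have hlowz := hV.const_le hβ0 hβ1 hp hr hzm
  have hwc : V (idleBelief p r z) = ω / (1 - β) := by
    refine le_antisymm ?_ hlow
    rcases le_max_iff.1 (hconv.le_max_of_mem_Icc hp hzm hw) with h | h <;> nlinarith
  have hzc : V z = ω / (1 - β) := by rw [h2, hwc]; linarith
  have hpc : V p = ω / (1 - β) := by rw [h1, hzc]; linarith
  intro y hy
  refine le_antisymm ?_ (hV.const_le hβ0 hβ1 hp hr ⟨hp.1.trans hy.1, hy.2.trans hzm.2⟩)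
  simpa [hzc, hpc] using hconv.le_max_of_mem_Icc hp hzm hy

theorem advantage_lt_of_le (hV : IsSubsidyValue β p r ω R V)
    (hV' : IsSubsidyValue β p r ω' R V')
    (hβ0 : 0 ≤ β) (hβ1 : β < 1) (hp : p ∈ Icc (0 : ℝ) 1) (hr : r ∈ Icc (0 : ℝ) 1)
    (hR : ConvexOn ℝ (Icc (0 : ℝ) 1) R) (hRm : MonotoneOn R (Icc (0 : ℝ) 1)) (hω : ω < ω')
    (hpr : p ≤ r) {x : ℝ} (hx : x ∈ Icc (0 : ℝ) 1) :
    advantage β p r ω' R V' x < advantage β p r ω R V x := by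
  have hp' : p ∈ Icc 0 r := ⟨hp.1, hpr⟩
  have hr' : r ∈ Icc 0 r := ⟨hr.1, le_rfl⟩
  rcases le_or_gt (R r) ω' with hRr | hRr
  · have hflat : ∀ y ∈ Icc 0 r, V' y = ω' / (1 - β) := fun y hy =>
      hV'.eq_const_of_reward_le hβ0 hβ1 hr.2 hp' hr'
        (fun z hz => (hRm ⟨hz.1, hz.2.trans hr.2⟩ hr hz.2).trans hRr) hy
    exact hV.advantage_lt_of_eq_const hβ0 hβ1 hp hr hR hω hx (hflat p hp') (hflat r hr')
      (hflat _ (idleBelief_mem_Icc hp' hr' hx))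
  have hDr : 0 ≤ advantage β p r ω R V r :=
    le_trans (by linarith) (hV.le_advantage hβ0 hβ1 hp hr hR hr)
  have hDr' : 0 ≤ advantage β p r ω' R V' r :=
    le_trans (by linarith) (hV'.le_advantage hβ0 hβ1 hp hr hR hr)
  have hΔr : V' r - V r = β * (r * (V' p - V p) + (1 - r) * (V' r - V r)) := by
    linarith [hV.eq_active hr hDr, hV'.eq_active hr hDr']
  suffices h : β * infoGain p r (fun y => V' y - V y) x < ω' - ω by
    linarith [advantage_sub_advantage β p r ω ω' R V V' x]
  have hz : idleBelief p r p ∈ Icc (0 : ℝ) 1 := idleBelief_mem_Icc hp hr hp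
  have hpz : p ≤ idleBelief p r p :=
    (idleBelief_mem_Icc (left_mem_Icc.2 hpr) (right_mem_Icc.2 hpr) hp).1
  have hzdef : idleBelief p r p = p * p + (1 - p) * r := rfl
  have hsubp := advantage_sub_advantage β p r ω ω' R V V' p
  have hsubz := advantage_sub_advantage β p r ω ω' R V V' (idleBelief p r p)
  by_cases hX : V' p - V p - β * (p * (V' p - V p) + (1 - p) * (V' r - V r)) ≤ ω' - ω
  · exact hV.mul_infoGain_sub_lt hV' hβ0 hβ1 hp hr hω hΔr hX hx
  rw [not_le] at hX
  have hn : infoGain p r (fun y => V' y - V y) p < 0 := by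
    by_contra! hn
    have hβn := mul_nonneg hβ0 hn
    rcases le_max_iff.1 (hV.sub_le_max hV' hp) with h | h
    · linarith
    · simp only [infoGain] at hβn
      linarith
  have hDp' : advantage β p r ω' R V' p < 0 := by
    by_contra! hDp'
    have hDp : 0 ≤ advantage β p r ω R V p := by
      linarith [mul_nonneg hβ0 (neg_nonneg.2 hn.le)]
    linarith [hV.eq_active hp hDp, hV'.eq_active hp hDp']
  have hz_active : ¬ V' (idleBelief p r p) - V (idleBelief p r p) ≤
      β * (idleBelief p r p * (V' p - V p) + (1 - idleBelief p r p) * (V' r - V r)) := by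
    intro h
    have hX' : 0 ≤ p * (V' p - V p - β * (p * (V' p - V p) + (1 - p) * (V' r - V r))) :=
      mul_nonneg hp.1 (by linarith)
    have h2 : p * (V' p - V p) + (1 - p) * (V' r - V r) -
        β * (idleBelief p r p * (V' p - V p) + (1 - idleBelief p r p) * (V' r - V r)) =
        p * (V' p - V p - β * (p * (V' p - V p) + (1 - p) * (V' r - V r))) := by
      rw [hzdef]
      linear_combination (1 - p) * hΔr
    simp only [infoGain] at hn
    linarith
  have hDz' : advantage β p r ω' R V' (idleBelief p r p) < 0 := by
    by_contra! hDz'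
    exact hz_active (by linarith [hV'.eq_active hz hDz', hV.active_le hz])
  have hflat := hV'.eq_const_of_idle_idle hβ0 hβ1 hp hr hR hpr hDp'.le hDz'.le
  exact hV.mul_infoGain_sub_lt_of_eq_const hV' hβ0 hβ1 hp hr hR hω hpr hΔr hn hflat hx

/-- With positive correlation, if being active is optimal at `p` for both subsidies and the
idle belief orbit of `s` increases, then a nonpositive advantage at `s` stays negative. The
values are compared after normalising the idle cost `R p - ω` to one. -/
theorem advantage_neg_of_le_idleBelief (hV : IsSubsidyValue β p r ω R V)
    (hV' : IsSubsidyValue β p r ω' R V')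
    (hβ0 : 0 ≤ β) (hβ1 : β < 1) (hp : p ∈ Icc (0 : ℝ) 1) (hr : r ∈ Icc (0 : ℝ) 1)
    (hR : ConvexOn ℝ (Icc (0 : ℝ) 1) R) (hRm : MonotoneOn R (Icc (0 : ℝ) 1)) (hω : ω < ω')
    (hrp : r ≤ p) (hRp : ω' < R p) {s : ℝ} (hs : s ∈ Icc (0 : ℝ) 1)
    (hsQ : s ≤ idleBelief p r s) (hD : advantage β p r ω R V s ≤ 0) :
    advantage β p r ω' R V' s < 0 := by
  by_contra! hD'
  have hp' : p ∈ Icc 0 p := ⟨hp.1, le_rfl⟩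
  have hr' : r ∈ Icc 0 p := ⟨hr.1, hrp⟩
  have hsub : Icc 0 p ⊆ Icc (0 : ℝ) 1 := Icc_subset_Icc_right hp.2
  have hQ : ∀ x ∈ Icc (0 : ℝ) 1, idleBelief p r x ∈ Icc 0 p := fun x hx =>
    idleBelief_mem_Icc hp' hr' hx
  have hε : 0 < ω' - ω := sub_pos.2 hω
  have h₁ : 0 < R p - ω := by linarith
  have h₁' : 0 < R p - ω' := by linarith
  set c := R p / (1 - β)
  have hc : c * (1 - β) = R p := div_mul_cancel₀ _ (sub_pos.2 hβ1).ne'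
  set Γ : ℝ → ℝ := fun x => (R p - ω) * (c - V' x) - (R p - ω') * (c - V x) with hΓ
  have hRle : ∀ x ∈ Icc 0 p, 0 ≤ R p - R x := fun x hx =>
    sub_nonneg.2 (hRm (hsub hx) hp hx.2)
  have hup : ∀ x ∈ Icc 0 p, Γ x ≤
      max ((ω' - ω) * (R p - R x) + β * (x * Γ p + (1 - x) * Γ r)) (β * Γ (idleBelief p r x)) := by
    intro x hx
    rw [le_max_iff]
    rcases le_total 0 (advantage β p r ω R V x) with h | h
    · left
      have e := hV.eq_active (hsub hx) h
      have i := mul_le_mul_of_nonneg_left (hV'.active_le (hsub hx)) h₁.le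
      simp only [hΓ]
      linear_combination i + (R p - ω') * e + (ω' - ω) * hc
    · right
      have e := hV.eq_idle (hsub hx) h
      have i := mul_le_mul_of_nonneg_left (hV'.idle_le (hsub hx)) h₁.le
      simp only [hΓ]
      linear_combination i + (R p - ω') * e + (ω' - ω) * hc
  have hlow : ∀ x ∈ Icc 0 p,
      min ((ω' - ω) * (R p - R x) + β * (x * Γ p + (1 - x) * Γ r)) (β * Γ (idleBelief p r x))
        ≤ Γ x := by
    intro x hx
    rw [min_le_iff]
    rcases le_total 0 (advantage β p r ω' R V' x) with h | h
    · left
      have e := hV'.eq_active (hsub hx) h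
      have i := mul_le_mul_of_nonneg_left (hV.active_le (hsub hx)) h₁'.le
      simp only [hΓ]
      linear_combination i + (R p - ω) * e + (ω - ω') * hc
    · right
      have e := hV'.eq_idle (hsub hx) h
      have i := mul_le_mul_of_nonneg_left (hV.idle_le (hsub hx)) h₁'.le
      simp only [hΓ]
      linear_combination i + (R p - ω) * e + (ω - ω') * hc
  obtain ⟨C, hC⟩ := hV.bounded
  obtain ⟨C', hC'⟩ := hV'.bounded
  have hbd : ∀ x ∈ Icc (0 : ℝ) 1,
      |Γ x| ≤ (R p - ω) * (|c| + C') + (R p - ω') * (|c| + C) := by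
    intro x hx
    refine (abs_sub _ _).trans ?_
    rw [abs_mul, abs_mul, abs_of_pos h₁, abs_of_pos h₁']
    have i := (abs_sub c (V' x)).trans (add_le_add_right (hC' x hx) _)
    have j := (abs_sub c (V x)).trans (add_le_add_right (hC x hx) _)
    gcongr
  have hnonneg : ∀ x ∈ Icc 0 p, 0 ≤ Γ x := by
    have key := nonpos_of_contracting_bound (S := Icc 0 p) (f := fun x => -Γ x) hβ0 hβ1
      (fun x hx => (neg_le_abs _).trans (hbd x (hsub hx))) (by
        intro K _ h x hx
        have j1 := mul_le_mul_of_nonneg_left (h _ (hQ x (hsub hx))) hβ0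
        have j2 := mul_le_mul_of_nonneg_left (h p hp') (hsub hx).1
        have j3 := mul_le_mul_of_nonneg_left (h r hr') (sub_nonneg.2 (hsub hx).2)
        have j4 := mul_le_mul_of_nonneg_left (add_le_add j2 j3) hβ0
        have j5 := mul_nonneg hε.le (hRle x hx)
        rcases min_le_iff.1 (hlow x hx) with i | i
        · linarith
        · linarith)
    exact fun x hx => neg_nonpos.1 (key x hx)
  have hΓp : Γ p = β * (p * Γ p + (1 - p) * Γ r) := by
    have e := hV.eq_active hp
      (le_trans (by linarith) (hV.le_advantage hβ0 hβ1 hp hr hR hp))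
    have e' := hV'.eq_active hp
      (le_trans (by linarith) (hV'.le_advantage hβ0 hβ1 hp hr hR hp))
    simp only [hΓ]
    linear_combination (R p - ω') * e - (R p - ω) * e' + (ω' - ω) * hc
  have hΓpr : Γ p ≤ Γ r := by
    have i := mul_le_mul_of_nonneg_right hβ1.le (hnonneg r hr')
    have j : β * p < 1 := (mul_le_of_le_one_right hβ0 hp.2).trans_lt hβ1
    refine le_of_mul_le_mul_left ?_ (sub_pos.2 j)
    linarith
  have hRs : R s < R p := by linarith [hV.le_advantage hβ0 hβ1 hp hr hR hs]
  set K := (ω' - ω) * (R p - R s) + β * (s * Γ p + (1 - s) * Γ r) with hK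
  have hKpos : 0 < K := by
    have i := mul_pos hε (sub_pos.2 hRs)
    have j := mul_nonneg hβ0 (add_nonneg (mul_nonneg hs.1 (hnonneg p hp'))
      (mul_nonneg (sub_nonneg.2 hs.2) (hnonneg r hr')))
    linarith
  have hΓK : ∀ x ∈ Icc s p, Γ x - K ≤ 0 := by
    have hsub' : Icc s p ⊆ Icc 0 p := Icc_subset_Icc_left hs.1
    refine nonpos_of_contracting_bound hβ0 hβ1
      (fun x hx => sub_le_sub_right ((le_abs_self _).trans (hbd x (hsub (hsub' hx)))) K) ?_
    intro M hM h x hx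
    have hxm := hsub (hsub' hx)
    have hQx : idleBelief p r x ∈ Icc s p :=
      ⟨hsQ.trans (idleBelief_mono hrp hx.1), (hQ x hxm).2⟩
    have j1 := mul_le_mul_of_nonneg_left (h _ hQx) hβ0
    have j2 := mul_le_mul_of_nonneg_left (hRm hs hxm hx.1) hε.le
    have j3 := mul_nonneg hβ0 (mul_nonneg (sub_nonneg.2 hx.1) (sub_nonneg.2 hΓpr))
    have j4 := mul_nonneg hβ0 hM
    have j5 := mul_le_mul_of_nonneg_right hβ1.le hKpos.le
    rcases le_max_iff.1 (hup x (hsub' hx)) with i | i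
    · linarith
    · linarith
  have hE : K ≤ β * Γ (idleBelief p r s) := by
    have i := mul_nonpos_of_nonneg_of_nonpos h₁'.le hD
    have j := mul_nonneg h₁.le hD'
    simp only [advantage] at i j
    simp only [hK, hΓ]
    linear_combination i + j
  have i := mul_le_mul_of_nonneg_left (hΓK _ ⟨hsQ, (hQ s hs).2⟩) hβ0
  have j := mul_lt_mul_of_pos_right hβ1 hKpos
  linarith

theorem advantage_neg_of_idle_below (hV : IsSubsidyValue β p r ω R V)
    (hV' : IsSubsidyValue β p r ω' R V')
    (hβ0 : 0 ≤ β) (hβ1 : β < 1) (hp : p ∈ Icc (0 : ℝ) 1) (hr : r ∈ Icc (0 : ℝ) 1)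
    (hR : ConvexOn ℝ (Icc (0 : ℝ) 1) R) (hRm : MonotoneOn R (Icc (0 : ℝ) 1)) (hω : ω < ω')
    {s : ℝ} (hs : s ∈ Icc (0 : ℝ) 1)
    (hbelow : ∀ x ∈ Ico 0 s, advantage β p r ω R V x ≤ 0)
    (hbelow' : ∀ x ∈ Ico 0 s, advantage β p r ω' R V' x ≤ 0)
    (hD : advantage β p r ω R V s ≤ 0) : advantage β p r ω' R V' s < 0 := by
  rcases le_total p r with hpr | hrp
  · exact (hV.advantage_lt_of_le hV' hβ0 hβ1 hp hr hR hRm hω hpr hs).trans_le hD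
  rcases le_or_gt (R p) ω' with hRp | hRp
  · have hp' : p ∈ Icc 0 p := ⟨hp.1, le_rfl⟩
    have hr' : r ∈ Icc 0 p := ⟨hr.1, hrp⟩
    have hflat : ∀ y ∈ Icc 0 p, V' y = ω' / (1 - β) := fun y hy =>
      hV'.eq_const_of_reward_le hβ0 hβ1 hp.2 hp' hr'
        (fun z hz => (hRm ⟨hz.1, hz.2.trans hp.2⟩ hp hz.2).trans hRp) hy
    exact (hV.advantage_lt_of_eq_const hβ0 hβ1 hp hr hR hω hs (hflat p hp') (hflat r hr')
      (hflat _ (idleBelief_mem_Icc hp' hr' hs))).trans_le hD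
  rcases le_or_gt s (idleBelief p r s) with hsQ | hsQ
  · exact hV.advantage_neg_of_le_idleBelief hV' hβ0 hβ1 hp hr hR hRm hω hrp hRp hs hsQ hD
  have hsub : Ico 0 s ⊆ Icc (0 : ℝ) 1 := fun x hx => ⟨hx.1, hx.2.le.trans hs.2⟩
  have hQ : ∀ x ∈ Ico 0 s, idleBelief p r x ∈ Ico 0 s := fun x hx =>
    ⟨(idleBelief_mem_Icc hp hr (hsub hx)).1, (idleBelief_mono hrp hx.2.le).trans_lt hsQ⟩
  have hQs : idleBelief p r s ∈ Ico 0 s := ⟨(idleBelief_mem_Icc hp hr hs).1, hsQ⟩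
  have hrs : r ∈ Ico 0 s :=
    ⟨hr.1, (idleBelief_mem_Icc ⟨hrp, le_rfl⟩ ⟨le_rfl, hrp⟩ hs).1.trans_lt hsQ⟩
  have hflat : ∀ x ∈ Ico 0 s, V x = ω / (1 - β) := fun x hx =>
    hV.eq_const_of_idle hβ0 hβ1 hp hr hsub hQ
      (fun y hy => hV.eq_idle (hsub hy) (hbelow y hy)) hx
  have hflat' : ∀ x ∈ Ico 0 s, V' x = ω' / (1 - β) := fun x hx =>
    hV'.eq_const_of_idle hβ0 hβ1 hp hr hsub hQ
      (fun y hy => hV'.eq_idle (hsub hy) (hbelow' y hy)) hx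
  have h1 := hV.sub_le_const hV' hβ0 hβ1 hp hr hω.le hp
  rw [sub_div] at h1
  have h2 := advantage_sub_advantage β p r ω ω' R V V' s
  simp only [infoGain, hflat _ hQs, hflat _ hrs, hflat' _ hQs, hflat' _ hrs] at h2
  have h3 := mul_nonneg hβ0 (mul_nonneg hs.1 (sub_nonneg.2 h1))
  linarith

end IsSubsidyValue

/-- Proposition 3 (Whittle indexability): the threshold
`π*(ω) = inf{π ∈ [0,1] : active branch ≥ idle branch}` of the `ω`-subsidy problem is
strictly increasing in the subsidy `ω` on `(δ, 1)`. -/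
theorem stmt_17 (β δ : ℝ) (hβ : β ∈ Ico (0:ℝ) 1) (hδ : δ ∈ Ico (0:ℝ) 1)
    (p r : ℝ) (hp : p ∈ Icc (0:ℝ) 1) (hr : r ∈ Icc (0:ℝ) 1) (hpr : p - r < 1)
    (Q : ℝ → ℝ) (hQ : ∀ x, Q x = x * p + (1 - x) * r)
    (R : ℝ → ℝ) (hRconv : ConvexOn ℝ (Icc (0:ℝ) 1) R)
    (hRcont : ContinuousOn R (Icc (0:ℝ) 1))
    (hR0 : R 0 = δ) (hR1 : R 1 = 1)
    (hRbounds : ∀ π ∈ Icc (0:ℝ) 1, max δ π ≤ R π ∧ R π ≤ (1 - δ) * π + δ)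
    (V : ℝ → ℝ → ℝ)
    (hVbd : ∀ ω ∈ Ioo δ 1, ∃ C : ℝ, ∀ π ∈ Icc (0:ℝ) 1, |V ω π| ≤ C)
    (hV : ∀ ω ∈ Ioo δ 1, ∀ π ∈ Icc (0:ℝ) 1,
      V ω π = max (R π + β * (π * V ω p + (1 - π) * V ω r)) (ω + β * V ω (Q π)))
    (πstar : ℝ → ℝ)
    (hπstar : ∀ ω ∈ Ioo δ 1, πstar ω = sInf {π ∈ Icc (0:ℝ) 1 |
      ω + β * V ω (Q π) ≤ R π + β * (π * V ω p + (1 - π) * V ω r)}) :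
    StrictMonoOn πstar (Ioo δ 1) := by
  obtain ⟨hβ0, hβ1⟩ := hβ
  obtain rfl : Q = idleBelief p r := funext hQ
  have hval : ∀ ω ∈ Ioo δ 1, IsSubsidyValue β p r ω R (V ω) := fun ω hω =>
    ⟨hVbd ω hω, hV ω hω⟩
  have hRm : MonotoneOn R (Icc (0 : ℝ) 1) := monotoneOn_of_convexOn_of_left_le hRconv
    fun x hx => hR0.trans_le ((le_max_left _ _).trans (hRbounds x hx).1)
  have hRlip' : ∀ x ∈ Icc (0 : ℝ) 1, ∀ y ∈ Icc (0 : ℝ) 1, x ≤ y → R y - R x ≤ y - x :=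
    fun x hx y hy hxy => sub_le_sub_of_convexOn hRconv hR1
      (fun z hz => (le_max_right _ _).trans (hRbounds z hz).1) hx hy hxy
  have hRlip : ∀ x ∈ Icc (0 : ℝ) 1, ∀ y ∈ Icc (0 : ℝ) 1, |R x - R y| ≤ |x - y| := by
    intro x hx y hy
    rcases le_total x y with h | h
    · rw [abs_sub_comm, abs_sub_comm x, abs_of_nonneg (sub_nonneg.2 h),
        abs_of_nonneg (sub_nonneg.2 (hRm hx hy h))]
      exact hRlip' x hx y hy h
    · rw [abs_of_nonneg (sub_nonneg.2 h), abs_of_nonneg (sub_nonneg.2 (hRm hy hx h))]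
      exact hRlip' y hy x hx h
  have hcont : ∀ ω ∈ Ioo δ 1, ContinuousOn (advantage β p r ω R (V ω)) (Icc (0 : ℝ) 1) :=
    fun ω hω => (hval ω hω).continuousOn_advantage hβ0 hβ1 hp hr hRlip hRcont
  have hset : ∀ ω ∈ Ioo δ 1, πstar ω =
      sInf (Icc (0 : ℝ) 1 ∩ advantage β p r ω R (V ω) ⁻¹' Ici 0) := by
    intro ω hω
    rw [hπstar ω hω]
    congr 1
    ext x
    simp [advantage, sub_nonneg]
  have hmem : ∀ ω ∈ Ioo δ 1,
      πstar ω ∈ Icc (0 : ℝ) 1 ∩ advantage β p r ω R (V ω) ⁻¹' Ici 0 := by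
    intro ω hω
    rw [hset ω hω]
    refine ((hcont ω hω).preimage_isClosed_of_isClosed isClosed_Icc isClosed_Ici).csInf_mem
      ⟨1, right_mem_Icc.2 zero_le_one, ?_⟩ ⟨0, fun x hx => hx.1.1⟩
    have := (hval ω hω).le_advantage hβ0 hβ1 hp hr hRconv (right_mem_Icc.2 zero_le_one)
    rw [hR1] at this
    exact le_trans (sub_nonneg.2 hω.2.le) this
  have hbelow : ∀ ω ∈ Ioo δ 1, ∀ x ∈ Ico 0 (πstar ω), advantage β p r ω R (V ω) x < 0 := by
    intro ω hω x hx
    by_contra! h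
    refine hx.2.not_ge ?_
    rw [hset ω hω]
    exact csInf_le ⟨0, fun y hy => hy.1.1⟩ ⟨⟨hx.1, hx.2.le.trans (hmem ω hω).1.2⟩, h⟩
  intro ω hω ω' hω' hlt
  by_contra! hle
  have hs := (hmem ω' hω').1
  refine ((hval ω hω).advantage_neg_of_idle_below (hval ω' hω') hβ0 hβ1 hp hr hRconv hRm hlt hs
    (fun x hx => (hbelow ω hω x ⟨hx.1, hx.2.trans_le hle⟩).le)
    (fun x hx => (hbelow ω' hω' x hx).le) ?_).not_ge (hmem ω' hω').2
  rcases hs.1.eq_or_lt with h0 | h0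
  · rw [← h0]
    simp only [advantage, idleBelief, hR0, zero_mul, sub_zero, one_mul, zero_add]
    linarith [hω.1]
  · refine ContinuousWithinAt.closure_le (s := Ico 0 (πstar ω')) (g := fun _ => 0) ?_
      ((hcont ω hω _ hs).mono fun x hx => ⟨hx.1, hx.2.le.trans hs.2⟩)
      continuousWithinAt_const fun x hx => (hbelow ω hω x ⟨hx.1, hx.2.trans_le hle⟩).le
    rw [closure_Ico h0.ne]
    exact right_mem_Icc.2 h0.le
end

section
/- Let β ∈ [0,1), δ ∈ [0,1), p, r ∈ [0,1] with r < p and p − r < 1, Q(x) = x·p + (1−x)·r, π⁰ = r/(1+r−p), and let R : [0,1] → ℝ be convex and continuous with R(0) = δ, R(1) = 1 and max{δ, π} ≤ R(π) ≤ (1−δ)·π + δ for all π ∈ [0,1]. For each ω ∈ ℝ, let V_ω be the unique bounded solution of the Bellman equation V_ω(π) = max{ R(π) + β·( π·V_ω(p) + (1−π)·V_ω(r) ), ω + β·V_ω(Q(π)) }. Then for every π with π⁰ ≤ π < p, the Whittle index W(π) := inf{ ω ∈ ℝ : ω + β·V_ω(Q(π)) ≥ R(π) + β·( π·V_ω(p)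 + (1−π)·V_ω(r) ) } equals ( β·π·R(p) + (1−βp)·R(π) ) / (1 + β·π − β·p). -/
open Set

lemma nonpos_of_forall_le_pow_mul {β t C : ℝ} (hβ : β ∈ Ico (0:ℝ) 1)
    (h : ∀ n : ℕ, t ≤ β ^ n * C) : t ≤ 0 := by
  have hlim := (tendsto_pow_atTop_nhds_zero_of_lt_one hβ.1 hβ.2).mul_const C
  rw [zero_mul] at hlim
  exact ge_of_tendsto' hlim h

lemma ConvexOn.monotoneOn_of_forall_left_le {f : ℝ → ℝ} {a b : ℝ}
    (hf : ConvexOn ℝ (Icc a b) f) (h : ∀ x ∈ Icc a b, f a ≤ f x) :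
    MonotoneOn f (Icc a b) := by
  intro x hx y hy hxy
  have ha : a ∈ Icc a b := ⟨le_rfl, hx.1.trans hx.2⟩
  have hle : f x ≤ max (f a) (f y) :=
    hf.le_max_of_mem_Icc ha hy ⟨hx.1, hxy⟩
  rwa [max_eq_right (h y hy)] at hle

section Bellman

variable {β p r ω C : ℝ} {R v : ℝ → ℝ}

lemma idle_update_mem_Icc (hp : p ∈ Icc (0:ℝ) 1) (hr : r ∈ Icc (0:ℝ) 1) {x : ℝ}
    (hx : x ∈ Icc (0:ℝ) 1) : x * p + (1 - x) * r ∈ Icc (0:ℝ) 1 := by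
  obtain ⟨hx0, hx1⟩ := hx
  obtain ⟨hp0, hp1⟩ := hp
  obtain ⟨hr0, hr1⟩ := hr
  constructor <;> nlinarith

/-- Bounded solutions of the Bellman equation are at least the value of idling forever. -/
lemma bellman_idle_forever_le (hβ : β ∈ Ico (0:ℝ) 1) (hp : p ∈ Icc (0:ℝ) 1)
    (hr : r ∈ Icc (0:ℝ) 1) (hvC : ∀ x ∈ Icc (0:ℝ) 1, |v x| ≤ C)
    (hv : ∀ x ∈ Icc (0:ℝ) 1, v x = max (R x + β * (x * v p + (1 - x) * v r))
      (ω + β * v (x * p + (1 - x) * r)))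
    {x : ℝ} (hx : x ∈ Icc (0:ℝ) 1) : ω / (1 - β) ≤ v x := by
  have key : ∀ n : ℕ, ∀ x ∈ Icc (0:ℝ) 1,
      ω / (1 - β) - v x ≤ β ^ n * (|ω / (1 - β)| + C) := by
    intro n
    induction n with
    | zero =>
      intro x hx
      linarith [neg_le_of_abs_le (hvC x hx), le_abs_self (ω / (1 - β))]
    | succ n ih =>
      intro x hx
      have hQ := mul_le_mul_of_nonneg_left (ih _ (idle_update_mem_Icc hp hr hx)) hβ.1
      have hidle : ω + β * v (x * p + (1 - x) * r) ≤ v x :=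
        (le_max_right _ _).trans_eq (hv x hx).symm
      have hω : ω = ω / (1 - β) - β * (ω / (1 - β)) := by
        have : 1 - β ≠ 0 := by linarith [hβ.2]
        field_simp
      rw [pow_succ']
      linarith
  exact sub_nonpos.1 (nonpos_of_forall_le_pow_mul hβ fun n => key n x hx)

lemma bellman_monotoneOn (hβ : β ∈ Ico (0:ℝ) 1) (hp : p ∈ Icc (0:ℝ) 1)
    (hr : r ∈ Icc (0:ℝ) 1) (hrp : r ≤ p) (hR : MonotoneOn R (Icc 0 1))
    (hvC : ∀ x ∈ Icc (0:ℝ) 1, |v x| ≤ C)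
    (hv : ∀ x ∈ Icc (0:ℝ) 1, v x = max (R x + β * (x * v p + (1 - x) * v r))
      (ω + β * v (x * p + (1 - x) * r))) :
    MonotoneOn v (Icc 0 1) := by
  have hC : 0 ≤ C := (abs_nonneg _).trans (hvC p hp)
  have key : ∀ n : ℕ, ∀ x ∈ Icc (0:ℝ) 1, ∀ y ∈ Icc (0:ℝ) 1, x ≤ y →
      v x - v y ≤ β ^ n * (2 * C) := by
    intro n
    induction n with
    | zero =>
      intro x hx y hy _
      linarith [le_of_abs_le (hvC x hx), neg_le_of_abs_le (hvC y hy)]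
    | succ n ih =>
      intro x hx y hy hxy
      have hB : 0 ≤ β ^ n * (2 * C) := mul_nonneg (pow_nonneg hβ.1 n) (by linarith)
      have hQ := mul_le_mul_of_nonneg_left
        (ih _ (idle_update_mem_Icc hp hr hx) _ (idle_update_mem_Icc hp hr hy)
          (by nlinarith)) hβ.1
      have hxy1 : (y - x) * (v r - v p) ≤ β ^ n * (2 * C) :=
        (mul_le_mul_of_nonneg_left (ih r hr p hp hrp) (sub_nonneg.2 hxy)).trans
          (mul_le_of_le_one_left hB (by linarith [hx.1, hy.2]))
      have hact := mul_le_mul_of_nonneg_left hxy1 hβ.1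
      have hRxy := hR hx hy hxy
      have h1 : R y + β * (y * v p + (1 - y) * v r) ≤ v y :=
        (le_max_left _ _).trans_eq (hv y hy).symm
      have h2 : ω + β * v (y * p + (1 - y) * r) ≤ v y :=
        (le_max_right _ _).trans_eq (hv y hy).symm
      have h3 : v x ≤ v y + β * (β ^ n * (2 * C)) := by
        rw [hv x hx]
        exact max_le (by linarith) (by linarith)
      rw [pow_succ']
      linarith
  intro x hx y hy hxy
  exact sub_nonpos.1 (nonpos_of_forall_le_pow_mul hβ fun n => key n x hx y hy hxy)

/-- If the idle update does not increase the belief `x` and idling is optimal there, then the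
value at `x` is that of idling forever. -/
lemma bellman_le_of_idle_optimal (hβ : β ∈ Ico (0:ℝ) 1) (hp : p ∈ Icc (0:ℝ) 1)
    (hr : r ∈ Icc (0:ℝ) 1) (hmono : MonotoneOn v (Icc 0 1)) {x : ℝ} (hx : x ∈ Icc (0:ℝ) 1)
    (hQx : x * p + (1 - x) * r ≤ x) (hidle : v x ≤ ω + β * v (x * p + (1 - x) * r)) :
    v x ≤ ω / (1 - β) := by
  have hle := mul_le_mul_of_nonneg_left (hmono (idle_update_mem_Icc hp hr hx) hx hQx) hβ.1
  rw [le_div_iff₀ (by linarith [hβ.2])]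
  linarith

end Bellman

/-- Second case of Proposition 4 (positively correlated channel): for beliefs
`π⁰ ≤ π < p`, the Whittle index equals
`(β π R(p) + (1 - β p) R(π)) / (1 + β π - β p)`. -/
theorem stmt_19 (β δ : ℝ) (hβ : β ∈ Ico (0:ℝ) 1) (hδ : δ ∈ Ico (0:ℝ) 1)
    (p r : ℝ) (hp : p ∈ Icc (0:ℝ) 1) (hr : r ∈ Icc (0:ℝ) 1)
    (hrp : r < p) (hpr : p - r < 1)
    (Q : ℝ → ℝ) (hQ : ∀ x, Q x = x * p + (1 - x) * r)
    (π0 : ℝ) (hπ0 : π0 = r / (1 + r - p))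
    (R : ℝ → ℝ) (hRconv : ConvexOn ℝ (Icc (0:ℝ) 1) R)
    (hRcont : ContinuousOn R (Icc (0:ℝ) 1))
    (hR0 : R 0 = δ) (hR1 : R 1 = 1)
    (hRbounds : ∀ π ∈ Icc (0:ℝ) 1, max δ π ≤ R π ∧ R π ≤ (1 - δ) * π + δ)
    (V : ℝ → ℝ → ℝ)
    (hVbd : ∀ ω : ℝ, ∃ C : ℝ, ∀ π ∈ Icc (0:ℝ) 1, |V ω π| ≤ C)
    (hV : ∀ ω : ℝ, ∀ π ∈ Icc (0:ℝ) 1,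
      V ω π = max (R π + β * (π * V ω p + (1 - π) * V ω r)) (ω + β * V ω (Q π))) :
    ∀ π : ℝ, π0 ≤ π → π < p →
      sInf {ω : ℝ |
          R π + β * (π * V ω p + (1 - π) * V ω r) ≤ ω + β * V ω (Q π)} =
        (β * π * R p + (1 - β * p) * R π) / (1 + β * π - β * p) := by
  intro π hπl hπp
  have hden : 0 < 1 + r - p := by linarith
  have hπQ : r ≤ π * (1 + r - p) := by rwa [hπ0, div_le_iff₀ hden] at hπl
  have hπ0' : 0 ≤ π := (div_nonneg hr.1 hden.le).trans (hπ0 ▸ hπl)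
  have hπI : π ∈ Icc (0:ℝ) 1 := ⟨hπ0', hπp.le.trans hp.2⟩
  have hrπ : r ≤ π := by nlinarith
  have hQπ : π * p + (1 - π) * r ≤ π := by linarith
  have hQp : p * p + (1 - p) * r ≤ p := by nlinarith [hp.2]
  have hRmono : MonotoneOn R (Icc 0 1) :=
    hRconv.monotoneOn_of_forall_left_le fun x hx =>
      hR0 ▸ (le_max_left δ x).trans (hRbounds x hx).1
  simp only [hQ] at hV ⊢
  have hβp : 0 < 1 - β * p := by nlinarith [hβ.1, hβ.2, hp.1, hp.2]
  have hβπ : 0 ≤ β * π := mul_nonneg hβ.1 hπ0'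
  have hD : 0 < 1 + β * π - β * p := by linarith
  have hβ1 : 0 < 1 - β := by linarith [hβ.2]
  have hmono : ∀ ω, MonotoneOn (V ω) (Icc 0 1) := fun ω =>
    (hVbd ω).elim fun _ hC => bellman_monotoneOn hβ hp hr hrp.le hRmono hC (hV ω)
  have hlow : ∀ ω, ∀ x ∈ Icc (0:ℝ) 1, ω / (1 - β) ≤ V ω x := fun ω x hx =>
    (hVbd ω).elim fun _ hC => bellman_idle_forever_le hβ hp hr hC (hV ω) hx
  have hc : ∀ ω : ℝ, ω = (1 - β) * (ω / (1 - β)) := fun ω => by field_simp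
  refine IsLeast.csInf_eq ⟨?_, ?_⟩
  · set ω := (β * π * R p + (1 - β * p) * R π) / (1 + β * π - β * p) with hω
    have hω' : ω * (1 + β * π - β * p) = β * π * R p + (1 - β * p) * R π := by
      rw [hω]; field_simp
    by_contra hlt
    rw [mem_ofPred_eq, not_le] at hlt
    have hact : V ω π = R π + β * (π * V ω p + (1 - π) * V ω r) := by
      rw [hV ω π hπI]; exact max_eq_left hlt.le
    have hb : ω / (1 - β) < V ω π := by
      have := mul_le_mul_of_nonneg_left (hlow ω _ (idle_update_mem_Icc hp hr hπI)) hβ.1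
      linarith [hc ω]
    have hsb := hmono ω hr hπI hrπ
    have hba := hmono ω hπI hp hπp.le
    have hactp : V ω p = R p + β * (p * V ω p + (1 - p) * V ω r) := by
      refine (max_choice _ _).elim (fun h => (hV ω p hp).trans h) fun h => ?_
      have := bellman_le_of_idle_optimal hβ hp hr (hmono ω) hp hQp ((hV ω p hp).trans h).le
      linarith
    have h1 : (V ω π - ω / (1 - β)) ≤ R π - ω + β * π * (V ω p - ω / (1 - β))
        + β * (1 - π) * (V ω π - ω / (1 - β)) := by
      have := mul_le_mul_of_nonneg_left hsb (mul_nonneg hβ.1 (sub_nonneg.2 hπI.2))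
      linarith [hc ω]
    have h2 : (1 - β * p) * (V ω p - ω / (1 - β)) ≤ R p - ω
        + β * (1 - p) * (V ω π - ω / (1 - β)) := by
      have := mul_le_mul_of_nonneg_left hsb (mul_nonneg hβ.1 (sub_nonneg.2 hp.2))
      linarith [hc ω]
    have h1' := mul_le_mul_of_nonneg_left h1 hβp.le
    have h2' := mul_le_mul_of_nonneg_left h2 hβπ
    have h3 : (1 - β) * (1 + β * π - β * p) * (V ω π - ω / (1 - β)) ≤ 0 := by linarith
    exact absurd h3 (not_le.2 (mul_pos (mul_pos hβ1 hD) (sub_pos.2 hb)))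
  · intro ω hω
    rw [mem_ofPred_eq] at hω
    have hidle := (hV ω π hπI).trans (max_eq_right hω)
    have hπle := bellman_le_of_idle_optimal hβ hp hr (hmono ω) hπI hQπ hidle.le
    have hπeq : V ω π = ω / (1 - β) := hπle.antisymm (hlow ω π hπI)
    have hreq : V ω r = ω / (1 - β) :=
      ((hmono ω hr hπI hrπ).trans hπle).antisymm (hlow ω r hr)
    have hactp : R p + β * (p * V ω p + (1 - p) * V ω r) ≤ V ω p :=
      (le_max_left _ _).trans_eq (hV ω p hp).symm
    rw [← hidle, hπeq, hreq] at hω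
    rw [hreq] at hactp
    have h1 : R π - ω + β * π * (V ω p - ω / (1 - β)) ≤ 0 := by linarith [hc ω]
    have h2 : R p - ω ≤ (1 - β * p) * (V ω p - ω / (1 - β)) := by linarith [hc ω]
    have h1' := mul_le_mul_of_nonneg_left h1 hβp.le
    have h2' := mul_le_mul_of_nonneg_left h2 hβπ
    rw [div_le_iff₀ hD]
    linarith
end
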